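/- arXiv:2501.13632 — 4 statements merged into one kernel-verified Lean document; each statement's English description precedes it below -/
import Mathlib

section
/- Fix b := 3/2, β := 2^{−11}, α > 0, a > 1, and for q ∈ ℕ set λ_q := a^{b^q−1}, δ_q := λ_q^{−4α}; for J ∈ 𝒥 with successor J+1 set λ_J := a^{b^{|J|}−1}, and within stage J (writing q = q(J), q* = q*(J)) set η := δ_{q+4} λ_{J+1}^{1−2α} and μ := λ_{J+1}^{1−4β}. If α > 0 is sufficiently small, then for every J ∈ 𝒥: (i) λ_{J+1}^{−β} ≤ δ_{q+1}^{3000} ≤ δ_{q+4} λ_{J+1}^{−α}; (ii) λ_J ≤ δ_{q+4} μ λ_{J+1}^{−β}; (iii) (δ_q/δ_{q+2})^{1/2} μ/η ≤ λ_{J+1}^{−3β}; (iv) (δ_q δ_{q*}/δ_{q+2})^{1/2} λ_J λ_{J+1}/(μη) ≤ λ_{J+1}^{−2β}. In particular, if in addition a > 1 is sufficiently large, then λ_J ≤ δ_q^{1/2} λ_{J+1}^{1−2β}. -/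
noncomputable section

open MeasureTheory Filter Topology

/-- Points/vectors of `ℝ³`. -/
abbrev V3 : Type := Fin 3 → ℝ

/-- Standard basis vectors. -/
def e3 (i : Fin 3) : V3 := fun j => if j = i then 1 else 0

/-- Euclidean scalar product. -/
def dot3 (a b : V3) : ℝ := ∑ i, a i * b i

/-- Euclidean norm. -/
def norm3 (a : V3) : ℝ := Real.sqrt (dot3 a a)

/-- Cross product. -/
def cross3 (a b : V3) : V3 :=
  ![a 1 * b 2 - a 2 * b 1, a 2 * b 0 - a 0 * b 2, a 0 * b 1 - a 1 * b 0]

/-- An integer vector, viewed in `ℝ³`. -/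
def intVec (m : Fin 3 → ℤ) : V3 := fun i => (m i : ℝ)

/-- `ℤ³`-periodicity: a function on `ℝ³` represents a function on `T³ = (ℝ/ℤ)³`. -/
def Per {F : Type*} (f : V3 → F) : Prop := ∀ (x : V3) (m : Fin 3 → ℤ), f (x + intVec m) = f x

/-- A lift of a (degree one) map `T³ → T³`. -/
def TorusMap (Φ : V3 → V3) : Prop :=
  ∀ (x : V3) (m : Fin 3 → ℤ), Φ (x + intVec m) = Φ x + intVec m

/-- Fundamental domain of the torus. -/
def cube3 : Set V3 := Set.univ.pi fun _ => Set.Ico (0:ℝ) 1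

/-- Gradient of a scalar function. -/
def grad3 (f : V3 → ℝ) (x : V3) : V3 := fun i => fderiv ℝ f x (e3 i)

/-- Divergence of a vector field. -/
def div3 (v : V3 → V3) (x : V3) : ℝ := ∑ i, fderiv ℝ v x (e3 i) i

/-- Divergence of a matrix-valued field, `(Div S)_i = ∂_j S_{ij}`. -/
def divM (S : V3 → Fin 3 → Fin 3 → ℝ) (x : V3) : V3 := fun i => ∑ j, fderiv ℝ S x (e3 j) i j

/-- Sup (C⁰) norm. -/
def C0Norm {F : Type*} [NormedAddCommGroup F] (f : V3 → F) : ℝ := ⨆ x, ‖f x‖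

/-- Sup norm over a set. -/
def C0NormOn {F : Type*} [NormedAddCommGroup F] (s : Set V3) (f : V3 → F) : ℝ :=
  ⨆ x : s, ‖f (x : V3)‖

/-- `C^N` norm (sum of sup-norms of iterated derivatives). -/
def CN {F : Type*} [NormedAddCommGroup F] [NormedSpace ℝ F] (N : ℕ) (f : V3 → F) : ℝ :=
  ∑ k ∈ Finset.range (N+1), ⨆ x, ‖iteratedFDeriv ℝ k f x‖

open Classical in
/-- Hölder seminorm of exponent `τ`. -/
def hsemi {F : Type*} [NormedAddCommGroup F] (τ : ℝ) (f : V3 → F) : ℝ :=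
  ⨆ p : V3 × V3, if p.1 = p.2 then 0 else ‖f p.1 - f p.2‖ / norm3 (p.1 - p.2) ^ τ

/-- `C^s` Hölder norm for a real exponent `s ≥ 0`. -/
def CsNorm {F : Type*} [NormedAddCommGroup F] [NormedSpace ℝ F] (s : ℝ) (f : V3 → F) : ℝ :=
  CN ⌊s⌋₊ f + hsemi (s - ⌊s⌋₊) (fun x => iteratedFDeriv ℝ ⌊s⌋₊ f x)

/-- Hölder continuity with exponent `τ`. -/
def HolderCont {F : Type*} [NormedAddCommGroup F] (τ : ℝ) (f : V3 → F) : Prop :=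
  ∃ C : ℝ, ∀ x y : V3, ‖f x - f y‖ ≤ C * norm3 (x - y) ^ τ

/-! ### Iteration parameters of the scheme -/

/-- `λ_q = a^{b^q - 1}` with `b = 3/2`. -/
def lam (a : ℝ) (q : ℕ) : ℝ := a ^ ((3/2 : ℝ) ^ q - 1)

/-- `δ_q = λ_q^{-4α}`. -/
def del (α a : ℝ) (q : ℕ) : ℝ := lam a q ^ (-(4 * α))

/-- `δ_q` extended to `ℤ` by `δ_{-1} := 1`. -/
def delZ (α a : ℝ) : ℤ → ℝ := fun q => if q < 0 then 1 else del α a q.toNat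

/-- The constant `β = 2^{-11}` of the scheme. -/
def betaConst : ℝ := 2 ^ (-(11:ℤ))

/-- `Ω_q = {x ∈ T³ : |v₀(x)| > δ_q^{1/2}/2}`. -/
def OmegaSet (α a : ℝ) (v0 : V3 → V3) (q : ℕ) : Set V3 :=
  {x | norm3 (v0 x) > del α a q ^ (1/2 : ℝ) / 2}

/-- The initial pressure `p₀ = -|v₀|²`. -/
def p0fun (v0 : V3 → V3) : V3 → ℝ := fun x => -(dot3 (v0 x) (v0 x))

/-- The initial Reynolds stress `R₀ = v₀ ⊗ v₀ - |v₀|² Id`. -/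
def R0fun (v0 : V3 → V3) : V3 → Fin 3 → Fin 3 → ℝ :=
  fun x i j => v0 x i * v0 x j - dot3 (v0 x) (v0 x) * (if i = j then 1 else 0)

/-- A subsolution `(v, p, R)` of the steady Euler equations on `T³`:
`Div(v ⊗ v) + ∇p = Div R`, `Div v = 0`, with `R` symmetric. -/
structure Subsolution (v : V3 → V3) (p : V3 → ℝ) (R : V3 → Fin 3 → Fin 3 → ℝ) : Prop where
  smoothV : ContDiff ℝ (⊤ : ℕ∞) v
  smoothP : ContDiff ℝ (⊤ : ℕ∞) p
  smoothR : ContDiff ℝ (⊤ : ℕ∞) R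
  perV : Per v
  perP : Per p
  perR : Per R
  symm : ∀ x i j, R x i j = R x j i
  euler : ∀ x : V3, ∀ j : Fin 3,
    (∑ i, fderiv ℝ (fun y => v y i * v y j) x (e3 i)) + fderiv ℝ p x (e3 j)
      = ∑ i, fderiv ℝ (fun y => R y j i) x (e3 i)
  divFree : ∀ x, div3 v x = 0

/-! ### The index set 𝒥 = ℕ × {0,…,7} × {0,…,7} -/

/-- The index set `𝒥`. -/
abbrev Jidx : Type := ℕ × Fin 8 × Fin 8

def qJ (J : Jidx) : ℕ := J.1
def jJ (J : Jidx) : ℕ := (J.2.1 : ℕ)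
def lJ (J : Jidx) : ℕ := (J.2.2 : ℕ)

/-- `|J| = q + j/8 + l/64`. -/
def absJ (J : Jidx) : ℝ := (qJ J : ℝ) + (jJ J : ℝ) / 8 + (lJ J : ℝ) / 64

/-- The lexicographic order on `𝒥` (encoded via `|·|`, which is strictly monotone for it). -/
def Jle (J J' : Jidx) : Prop := absJ J ≤ absJ J'

/-- The successor of `J` in the lexicographic order. -/
def succJ (J : Jidx) : Jidx :=
  if h : lJ J < 7 then (J.1, J.2.1, ⟨lJ J + 1, by omega⟩)
  else if h2 : jJ J < 7 then (J.1, ⟨jJ J + 1, by omega⟩, (0 : Fin 8))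
  else (J.1 + 1, (0 : Fin 8), (0 : Fin 8))

/-- `λ_J = a^{b^{|J|} - 1}`. -/
def lamJ (a : ℝ) (J : Jidx) : ℝ := a ^ ((3/2 : ℝ) ^ (absJ J) - 1)

/-- `q*(J) ∈ ℤ` : `q - 1` if `j = l = 0`, and `q` otherwise. -/
def qstarJ (J : Jidx) : ℤ := if jJ J = 0 ∧ lJ J = 0 then (qJ J : ℤ) - 1 else (qJ J : ℤ)

/-- `s(J) = 1280 + 80 j + 10 l`. -/
def sJ (J : Jidx) : ℝ := 1280 + 80 * (jJ J : ℝ) + 10 * (lJ J : ℝ)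

/-- `M(J) = 1 + 2^{13}(1 - 2^{-q}) + (8j + l) 2^{6-q}`. -/
def MJ (J : Jidx) : ℝ :=
  1 + 2 ^ (13:ℕ) * (1 - (2:ℝ) ^ (-(qJ J : ℤ))) +
    (8 * (jJ J : ℝ) + (lJ J : ℝ)) * (2:ℝ) ^ ((6:ℤ) - (qJ J : ℤ))

/-- `Ω_q` for an integer index (only used with `q ≥ 0`). -/
def OmegaSetZ (α a : ℝ) (v0 : V3 → V3) (q : ℤ) : Set V3 := OmegaSet α a v0 q.toNat

/-- Within stage `J`: `η := δ_{q+4} λ_{J+1}^{1-2α}`. -/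
def etaJ (α a : ℝ) (J : Jidx) : ℝ := del α a (qJ J + 4) * lamJ a (succJ J) ^ (1 - 2*α)

/-- Within stage `J`: `μ := λ_{J+1}^{1-4β}`. -/
def muJ (a : ℝ) (J : Jidx) : ℝ := lamJ a (succJ J) ^ (1 - 4 * betaConst)

lemma absJ_succJ (J : Jidx) : absJ (succJ J) = absJ J + 1 / 64 := by
  obtain ⟨q, j, l⟩ := J
  have hj := j.isLt
  have hl := l.isLt
  unfold succJ
  split_ifs with h h2
  · simp only [absJ, qJ, jJ, lJ]
    push_cast
    ring
  · simp only [jJ, lJ] at h h2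
    have hl7 : (l : ℕ) = 7 := by omega
    simp only [absJ, qJ, jJ, lJ, hl7]
    push_cast
    simp
    ring
  · simp only [jJ, lJ] at h h2
    have hl7 : (l : ℕ) = 7 := by omega
    have hj7 : (j : ℕ) = 7 := by omega
    simp only [absJ, qJ, jJ, lJ, hl7, hj7]
    push_cast
    simp
    ring

lemma qJ_le_absJ (J : Jidx) : (qJ J : ℝ) ≤ absJ J := by
  unfold absJ
  have : (0 : ℝ) ≤ (jJ J : ℝ) / 8 + (lJ J : ℝ) / 64 := by positivity
  linarith

lemma absJ_succJ_le (J : Jidx) : absJ (succJ J) ≤ qJ J + 1 := by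
  rw [absJ_succJ]
  have hj : (jJ J : ℝ) ≤ 7 := by
    have h : jJ J ≤ 7 := Nat.le_of_lt_succ J.2.1.isLt
    exact_mod_cast h
  have hl : (lJ J : ℝ) ≤ 7 := by
    have h : lJ J ≤ 7 := Nat.le_of_lt_succ J.2.2.isLt
    exact_mod_cast h
  unfold absJ
  linarith

lemma le_three_halves_rpow : (1.006 : ℝ) ≤ (3 / 2 : ℝ) ^ (1 / 64 : ℝ) := by
  rw [one_div]
  have h := Real.pow_rpow_inv_natCast (x := 1.006) (n := 64) (by norm_num) (by norm_num)
  rw [← h]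
  push_cast
  exact Real.rpow_le_rpow (by positivity) (by norm_num) (by norm_num)

lemma three_halves_pow_bounds (J : Jidx) :
    (1 : ℝ) ≤ (3 / 2 : ℝ) ^ qJ J ∧
    (3 / 2 : ℝ) ^ qJ J ≤ (3 / 2 : ℝ) ^ absJ J ∧
    1.006 * (3 / 2 : ℝ) ^ absJ J ≤ (3 / 2 : ℝ) ^ absJ (succJ J) ∧
    (3 / 2 : ℝ) ^ absJ (succJ J) ≤ 3 / 2 * (3 / 2 : ℝ) ^ qJ J := by
  refine ⟨one_le_pow₀ (by norm_num), ?_, ?_, ?_⟩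
  · rw [← Real.rpow_natCast]
    exact Real.rpow_le_rpow_of_exponent_le (by norm_num) (qJ_le_absJ J)
  · rw [absJ_succJ, Real.rpow_add (by norm_num), mul_comm]
    exact mul_le_mul_of_nonneg_left le_three_halves_rpow (by positivity)
  · refine (Real.rpow_le_rpow_of_exponent_le (by norm_num) (absJ_succJ_le J)).trans_eq ?_
    rw [Real.rpow_add (by norm_num), Real.rpow_one, Real.rpow_natCast, mul_comm]

lemma del_eq {a : ℝ} (ha : 0 < a) (α : ℝ) (q : ℕ) :
    del α a q = a ^ (((3 / 2 : ℝ) ^ q - 1) * (-(4 * α))) := by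
  rw [del, lam, ← Real.rpow_mul ha.le]

lemma delZ_eq_rpow {a : ℝ} (ha : 0 < a) (α : ℝ) (n : ℤ) :
    ∃ y : ℝ, 0 ≤ y ∧ delZ α a n = a ^ (y * (-(4 * α))) := by
  by_cases h : n < 0
  · exact ⟨0, le_rfl, by simp [delZ, h]⟩
  · exact ⟨(3 / 2 : ℝ) ^ n.toNat - 1, sub_nonneg.2 (one_le_pow₀ (by norm_num)), by
      simp only [delZ, h, if_false, del_eq ha]⟩

lemma betaConst_eq : betaConst = 1 / 2048 := by norm_num [betaConst]

/-- **Lemma 4.1 (relations between the parameters of the scheme).** If `α > 0` is small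
enough then, for every `a > 1` and every `J ∈ 𝒥` (writing `q = q(J)`, `q* = q*(J)`):
(i) `λ_{J+1}^{-β} ≤ δ_{q+1}^{3000} ≤ δ_{q+4} λ_{J+1}^{-α}`;
(ii) `λ_J ≤ δ_{q+4} μ λ_{J+1}^{-β}`;
(iii) `(δ_q/δ_{q+2})^{1/2} μ/η ≤ λ_{J+1}^{-3β}`;
(iv) `(δ_q δ_{q*}/δ_{q+2})^{1/2} λ_J λ_{J+1}/(μη) ≤ λ_{J+1}^{-2β}`.
In particular, for `a > 1` large enough, `λ_J ≤ δ_q^{1/2} λ_{J+1}^{1-2β}`. -/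
theorem parameter_relations :
    ∃ α₀ : ℝ, 0 < α₀ ∧ ∀ α : ℝ, 0 < α → α ≤ α₀ →
      ((∀ a : ℝ, 1 < a → ∀ J : Jidx,
        -- (i)
        lamJ a (succJ J) ^ (-betaConst) ≤ del α a (qJ J + 1) ^ (3000:ℝ) ∧
        del α a (qJ J + 1) ^ (3000:ℝ) ≤ del α a (qJ J + 4) * lamJ a (succJ J) ^ (-α) ∧
        -- (ii)
        lamJ a J ≤ del α a (qJ J + 4) * muJ a J * lamJ a (succJ J) ^ (-betaConst) ∧
        -- (iii)
        (del α a (qJ J) / del α a (qJ J + 2)) ^ (1/2:ℝ) * (muJ a J / etaJ α a J)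
          ≤ lamJ a (succJ J) ^ (-(3 * betaConst)) ∧
        -- (iv)
        (del α a (qJ J) * delZ α a (qstarJ J) / del α a (qJ J + 2)) ^ (1/2:ℝ)
            * (lamJ a J * lamJ a (succJ J) / (muJ a J * etaJ α a J))
          ≤ lamJ a (succJ J) ^ (-(2 * betaConst))) ∧
      -- in particular, for `a` large enough
      (∃ a₀ : ℝ, 1 < a₀ ∧ ∀ a : ℝ, a₀ ≤ a → ∀ J : Jidx,
        lamJ a J ≤ del α a (qJ J) ^ (1/2:ℝ) * lamJ a (succJ J) ^ (1 - 2 * betaConst))) := by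
  refine ⟨1 / 10 ^ 10, by positivity, fun α hα hα₀ =>
    ⟨fun a ha J => ?_, 2, one_lt_two, fun a ha J => ?_⟩⟩
  · have ha0 : 0 < a := one_pos.trans ha
    obtain ⟨hQ1, hQT, hTS, hSQ⟩ := three_halves_pow_bounds J
    obtain ⟨y, hy0, hy⟩ := delZ_eq_rpow ha0 α (qstarJ J)
    simp only [lamJ, muJ, etaJ, del_eq ha0, hy, betaConst_eq, pow_add, ← Real.rpow_mul ha0.le,
      ← Real.rpow_add ha0, ← Real.rpow_sub ha0, Real.rpow_le_rpow_left_iff ha]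
    generalize (3 / 2 : ℝ) ^ qJ J = Q at *
    generalize (3 / 2 : ℝ) ^ absJ J = T at *
    generalize (3 / 2 : ℝ) ^ absJ (succJ J) = S at *
    have hαQ : α * Q ≤ 1 / 10 ^ 10 * Q := by gcongr
    have hαQ' : α * 1 ≤ α * Q := by gcongr
    have hαS : α * S ≤ α * (3 / 2 * Q) := by gcongr
    have hαy : 0 ≤ α * y := by positivity
    refine ⟨?_, ?_, ?_, ?_, ?_⟩ <;> norm_num at * <;> nlinarith
  · have ha1 : 1 < a := one_lt_two.trans_le ha
    have ha0 : 0 < a := one_pos.trans ha1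
    obtain ⟨hQ1, hQT, hTS, hSQ⟩ := three_halves_pow_bounds J
    simp only [lamJ, del_eq ha0, betaConst_eq, ← Real.rpow_mul ha0.le,
      ← Real.rpow_add ha0, Real.rpow_le_rpow_left_iff ha1]
    generalize (3 / 2 : ℝ) ^ qJ J = Q at *
    generalize (3 / 2 : ℝ) ^ absJ J = T at *
    generalize (3 / 2 : ℝ) ^ absJ (succJ J) = S at *
    have hαQ : α * Q ≤ 1 / 10 ^ 10 * Q := by gcongr
    norm_num at *
    nlinarith
end
end

section
/- Let Ω ⊂ ℝ³ be a bounded domain with smooth boundary and let S0 ∈ C^∞(∂Ω, 𝒮³) be a smooth field of symmetric 3×3 matrices on ∂Ω satisfying S0 ν = 0, where ν is the outer unit normal to ∂Ω. Then there exists S ∈ C^∞(Ω̄, 𝒮³) such that Div S = 0 in Ω and S|_{∂Ω} = S0. -/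
noncomputable section

open MeasureTheory Filter Topology

/-- A bounded domain with smooth boundary, given by a defining function. -/
structure SmoothDomain (Ω : Set V3) : Prop where
  isOpen : IsOpen Ω
  bounded : Bornology.IsBounded Ω
  nonempty : Ω.Nonempty
  defFun : ∃ f : V3 → ℝ, ContDiff ℝ (⊤ : ℕ∞) f ∧ Ω = {x | f x < 0} ∧
    ∀ x ∈ frontier Ω, f x = 0 ∧ grad3 f x ≠ (0 : V3)

/-- The partial derivative `∂ᵢ u` of a scalar function. -/
def partialDeriv3 (i : Fin 3) (u : V3 → ℝ) (x : V3) : ℝ := fderiv ℝ u x (e3 i)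

lemma ContDiff.partialDeriv3 {u : V3 → ℝ} (hu : ContDiff ℝ (⊤ : ℕ∞) u) (i : Fin 3) :
    ContDiff ℝ (⊤ : ℕ∞) (partialDeriv3 i u) :=
  (hu.fderiv_right (m := ((⊤ : ℕ∞) : WithTop ℕ∞)) (by simp)).clm_apply contDiff_const

lemma ContDiff.differentiable_of_top {u : V3 → ℝ} (hu : ContDiff ℝ (⊤ : ℕ∞) u) :
    Differentiable ℝ u :=
  hu.differentiable (by simp)

lemma partialDeriv3_comm {u : V3 → ℝ} (hu : ContDiff ℝ (⊤ : ℕ∞) u) (i j : Fin 3) :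
    partialDeriv3 i (partialDeriv3 j u) = partialDeriv3 j (partialDeriv3 i u) := by
  have hd : Differentiable ℝ (fderiv ℝ u) :=
    (hu.fderiv_right (m := ((⊤ : ℕ∞) : WithTop ℕ∞)) (by simp)).differentiable (by simp)
  have key (k l : Fin 3) (x : V3) : partialDeriv3 k (partialDeriv3 l u) x =
      fderiv ℝ (fderiv ℝ u) x (e3 k) (e3 l) := by
    unfold partialDeriv3
    rw [fderiv_clm_apply (hd x) (differentiableAt_const _)]
    simp
  funext x
  have hs : IsSymmSndFDerivAt ℝ u x := hu.contDiffAt.isSymmSndFDerivAt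
    (by simpa using WithTop.coe_le_coe.2 (le_top : (2 : ℕ∞) ≤ ⊤))
  rw [key, key, hs.eq]

lemma partialDeriv3_add {u v : V3 → ℝ} (hu : Differentiable ℝ u) (hv : Differentiable ℝ v)
    (i : Fin 3) : partialDeriv3 i (fun x => u x + v x) =
      fun x => partialDeriv3 i u x + partialDeriv3 i v x := by
  funext x
  simp [partialDeriv3, fderiv_fun_add (hu x) (hv x)]

lemma partialDeriv3_sub {u v : V3 → ℝ} (hu : Differentiable ℝ u) (hv : Differentiable ℝ v)
    (i : Fin 3) : partialDeriv3 i (fun x => u x - v x) =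
      fun x => partialDeriv3 i u x - partialDeriv3 i v x := by
  funext x
  simp [partialDeriv3, fderiv_fun_sub (hu x) (hv x)]

lemma partialDeriv3_mul {u v : V3 → ℝ} (hu : Differentiable ℝ u) (hv : Differentiable ℝ v)
    (i : Fin 3) : partialDeriv3 i (fun x => u x * v x) =
      fun x => u x * partialDeriv3 i v x + partialDeriv3 i u x * v x := by
  funext x
  simp [partialDeriv3, fderiv_fun_mul (hu x) (hv x), mul_comm]

/-- On the zero set of `f`, the second derivatives of `f² b` only involve the value of `b`. -/
lemma partialDeriv3_partialDeriv3_sq_mul {f b : V3 → ℝ} (hf : ContDiff ℝ (⊤ : ℕ∞) f)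
    (hb : ContDiff ℝ (⊤ : ℕ∞) b) {x : V3} (hx : f x = 0) (k l : Fin 3) :
    partialDeriv3 k (partialDeriv3 l fun y => f y * (f y * b y)) x =
      2 * partialDeriv3 k f x * partialDeriv3 l f x * b x := by
  have hfb : ContDiff ℝ (⊤ : ℕ∞) fun y => f y * b y := hf.mul hb
  rw [partialDeriv3_mul hf.differentiable_of_top hfb.differentiable_of_top,
    partialDeriv3_add (hf.mul (hfb.partialDeriv3 l)).differentiable_of_top
      ((hf.partialDeriv3 l).mul hfb).differentiable_of_top,
    partialDeriv3_mul hf.differentiable_of_top (hfb.partialDeriv3 l).differentiable_of_top,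
    partialDeriv3_mul (hf.partialDeriv3 l).differentiable_of_top hfb.differentiable_of_top,
    partialDeriv3_mul hf.differentiable_of_top hb.differentiable_of_top,
    partialDeriv3_mul hf.differentiable_of_top hb.differentiable_of_top]
  simp only [hx]
  ring

/-- The incompatibility operator `(inc A)ᵢⱼ = εᵢₖₘ εⱼₗₙ ∂ₖ∂ₗ Aₘₙ`, with the Levi-Civita symbols
expanded through cyclic indices. -/
def incompatibility (A : Fin 3 → Fin 3 → V3 → ℝ) (x : V3) (i j : Fin 3) : ℝ :=
  partialDeriv3 (i + 1) (partialDeriv3 (j + 1) (A (i + 2) (j + 2))) x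
    - partialDeriv3 (i + 1) (partialDeriv3 (j + 2) (A (i + 2) (j + 1))) x
    - partialDeriv3 (i + 2) (partialDeriv3 (j + 1) (A (i + 1) (j + 2))) x
    + partialDeriv3 (i + 2) (partialDeriv3 (j + 2) (A (i + 1) (j + 1))) x

section Incompatibility

variable {A : Fin 3 → Fin 3 → V3 → ℝ}

lemma contDiff_incompatibility (hA : ∀ i j, ContDiff ℝ (⊤ : ℕ∞) (A i j)) :
    ContDiff ℝ (⊤ : ℕ∞) (incompatibility A) := by
  have h (i j k l : Fin 3) := ((hA i j).partialDeriv3 k).partialDeriv3 l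
  refine contDiff_pi.2 fun i => contDiff_pi.2 fun j => ?_
  exact (((h _ _ _ _).sub (h _ _ _ _)).sub (h _ _ _ _)).add (h _ _ _ _)

lemma incompatibility_symm (hA : ∀ i j, ContDiff ℝ (⊤ : ℕ∞) (A i j))
    (hsymm : ∀ i j, A i j = A j i) (x : V3) (i j : Fin 3) :
    incompatibility A x i j = incompatibility A x j i := by
  unfold incompatibility
  rw [partialDeriv3_comm (hA _ _) (j + 1) (i + 1), partialDeriv3_comm (hA _ _) (j + 1) (i + 2),
    partialDeriv3_comm (hA _ _) (j + 2) (i + 1), partialDeriv3_comm (hA _ _) (j + 2) (i + 2),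
    hsymm (j + 2) (i + 2), hsymm (j + 2) (i + 1), hsymm (j + 1) (i + 2), hsymm (j + 1) (i + 1)]
  ring

lemma divM_incompatibility (hA : ∀ i j, ContDiff ℝ (⊤ : ℕ∞) (A i j)) (x : V3) :
    divM (incompatibility A) x = 0 := by
  have h (i j k l : Fin 3) := ((hA i j).partialDeriv3 k).partialDeriv3 l
  have hentry (i j : Fin 3) : fderiv ℝ (incompatibility A) x (e3 j) i j =
      partialDeriv3 j (fun y => incompatibility A y i j) x := by
    have hd := (contDiff_incompatibility hA).differentiable (by simp)
    have hdi : Differentiable ℝ fun y => incompatibility A y i := differentiable_pi.1 hd i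
    rw [partialDeriv3, fderiv_apply (hdi x) j, fderiv_apply (hd x) i]
    rfl
  have hexpand (i j : Fin 3) : partialDeriv3 j (fun y => incompatibility A y i j) x =
      partialDeriv3 (i + 1) (partialDeriv3 j (partialDeriv3 (j + 1) (A (i + 2) (j + 2)))) x
        - partialDeriv3 (i + 1) (partialDeriv3 j (partialDeriv3 (j + 2) (A (i + 2) (j + 1)))) x
        - partialDeriv3 (i + 2) (partialDeriv3 j (partialDeriv3 (j + 1) (A (i + 1) (j + 2)))) x
        + partialDeriv3 (i + 2)
          (partialDeriv3 j (partialDeriv3 (j + 2) (A (i + 1) (j + 1)))) x := by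
    unfold incompatibility
    rw [partialDeriv3_add (((h _ _ _ _).sub (h _ _ _ _)).sub (h _ _ _ _)).differentiable_of_top
        (h _ _ _ _).differentiable_of_top,
      partialDeriv3_sub ((h _ _ _ _).sub (h _ _ _ _)).differentiable_of_top
        (h _ _ _ _).differentiable_of_top,
      partialDeriv3_sub (h _ _ _ _).differentiable_of_top (h _ _ _ _).differentiable_of_top]
    simp only [partialDeriv3_comm ((hA _ _).partialDeriv3 _) j]
  funext i
  simp only [divM, hentry, hexpand, Fin.sum_univ_three, Pi.zero_apply]
  have h11 : (1 : Fin 3) + 1 = 2 := rfl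
  have h12 : (1 : Fin 3) + 2 = 0 := rfl
  have h21 : (2 : Fin 3) + 1 = 0 := rfl
  have h22 : (2 : Fin 3) + 2 = 1 := rfl
  simp only [zero_add, h11, h12, h21, h22]
  rw [partialDeriv3_comm (hA _ _) 1 0, partialDeriv3_comm (hA _ _) 2 0,
    partialDeriv3_comm (hA _ _) 2 1, partialDeriv3_comm (hA _ _) 1 0,
    partialDeriv3_comm (hA _ _) 2 0, partialDeriv3_comm (hA _ _) 2 1]
  ring

end Incompatibility

/-- Conjugation `N M Nᵀ` of a matrix by the cross product matrix `N` of `n`. -/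
def crossConj (n : V3) (M : Fin 3 → Fin 3 → ℝ) (i j : Fin 3) : ℝ :=
  n (i + 1) * n (j + 1) * M (i + 2) (j + 2) - n (i + 1) * n (j + 2) * M (i + 2) (j + 1)
    - n (i + 2) * n (j + 1) * M (i + 1) (j + 2) + n (i + 2) * n (j + 2) * M (i + 1) (j + 1)

lemma crossConj_symm (n : V3) {M : Fin 3 → Fin 3 → ℝ} (hM : ∀ i j, M i j = M j i) (i j : Fin 3) :
    crossConj n M i j = crossConj n M j i := by
  unfold crossConj
  rw [hM (j + 2) (i + 2), hM (j + 2) (i + 1), hM (j + 1) (i + 2), hM (j + 1) (i + 1)]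
  ring

lemma crossConj_smul (n : V3) (c : ℝ) (M : Fin 3 → Fin 3 → ℝ) (i j : Fin 3) :
    crossConj n (fun k l => c * M k l) i j = c * crossConj n M i j := by
  unfold crossConj
  ring

/-- `N² = n nᵀ - |n|²`, so conjugating twice multiplies a symmetric matrix killing `n` by
`|n|⁴`. -/
lemma crossConj_crossConj (n : V3) {M : Fin 3 → Fin 3 → ℝ} (hM : ∀ i j, M i j = M j i)
    (hn : ∀ i, ∑ k, M i k * n k = 0) (i j : Fin 3) :
    crossConj n (crossConj n M) i j = dot3 n n ^ 2 * M i j := by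
  have key : n i * n j * ∑ l, n l * ∑ k, M l k * n k
      - dot3 n n * (n i * ∑ k, M j k * n k + n j * ∑ k, M i k * n k) = 0 := by
    simp [hn]
  simp only [crossConj, dot3, Fin.sum_univ_three] at key ⊢
  fin_cases i <;> fin_cases j <;>
    simp only [Fin.zero_eta, Fin.mk_one, Fin.reduceFinMk, Fin.reduceAdd, zero_add, Fin.isValue,
      hM 1 0, hM 2 0, hM 2 1] at key ⊢ <;>
    linear_combination key

/-- **Proposition 8.1 (divergence-free symmetric extension of boundary data).** Let
`Ω ⊂ ℝ³` be a bounded domain with smooth boundary, and let `S₀` be a smooth field of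
symmetric 3×3 matrices on `∂Ω` with `S₀ ν = 0`, `ν` being the outer normal. Then there is a
smooth symmetric matrix field `S` on `Ω̄` with `Div S = 0` in `Ω` and `S = S₀` on `∂Ω`.
(The normal direction is expressed through any defining function of the domain.) -/
theorem divergence_free_symmetric_extension
    (Ω : Set V3) (hΩ : SmoothDomain Ω)
    (S0 : V3 → Fin 3 → Fin 3 → ℝ) (hS0smooth : ContDiff ℝ (⊤ : ℕ∞) S0)
    (hS0symm : ∀ x i j, S0 x i j = S0 x j i)
    -- `S₀ ν = 0` on `∂Ω`: for every defining function `f` of `Ω`, the field `S₀`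
    -- annihilates `∇f` (which is parallel to the outer normal) on `∂Ω`
    (hS0tangent : ∀ f : V3 → ℝ, ContDiff ℝ (⊤ : ℕ∞) f → Ω = {x | f x < 0} →
      (∀ x ∈ frontier Ω, f x = 0 ∧ grad3 f x ≠ (0 : V3)) →
      ∀ x ∈ frontier Ω, ∀ i : Fin 3, (∑ k, S0 x i k * grad3 f x k) = 0) :
    ∃ S : V3 → Fin 3 → Fin 3 → ℝ,
      ContDiff ℝ (⊤ : ℕ∞) S ∧
      (∀ x i j, S x i j = S x j i) ∧
      (∀ x ∈ Ω, divM S x = (0 : V3)) ∧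
      (∀ x ∈ frontier Ω, S x = S0 x) := by
  obtain ⟨f, hf, hΩf, hfr⟩ := hΩ.defFun
  have htan := hS0tangent f hf hΩf hfr
  obtain ⟨κ, hκsupp, hκ, hκrange⟩ :=
    (isClosed_frontier (s := Ω)).isOpen_compl.exists_contDiff_support_eq (n := ⊤)
  have hκ0 : ∀ x ∈ frontier Ω, κ x = 0 := fun x hx => by
    by_contra h
    exact (hκsupp.le h : x ∈ (frontier Ω)ᶜ) hx
  have hκpos : ∀ x ∉ frontier Ω, 0 < κ x := fun x hx =>
    lt_of_le_of_ne (hκrange ⟨x, rfl⟩).1 (Ne.symm (hκsupp.ge hx))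
  have hgrad : ∀ k, ContDiff ℝ (⊤ : ℕ∞) fun x => grad3 f x k := fun k => hf.partialDeriv3 k
  have hnorm : ∀ x, grad3 f x ≠ 0 → 0 < dot3 (grad3 f x) (grad3 f x) := fun x hx => by
    obtain ⟨k, hk⟩ := Function.ne_iff.1 hx
    exact Finset.sum_pos' (fun i _ => mul_self_nonneg _) ⟨k, Finset.mem_univ k,
      mul_self_pos.2 hk⟩
  let q : V3 → ℝ := fun x => 2 * (dot3 (grad3 f x) (grad3 f x) ^ 2 + κ x)
  have hq : ContDiff ℝ (⊤ : ℕ∞) q := by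
    have : ContDiff ℝ (⊤ : ℕ∞) fun x => dot3 (grad3 f x) (grad3 f x) :=
      ContDiff.sum fun i _ => (hgrad i).mul (hgrad i)
    exact contDiff_const.mul ((this.pow 2).add hκ)
  have hq0 : ∀ x, q x ≠ 0 := fun x => by
    by_cases hx : x ∈ frontier Ω
    · have := hnorm x (hfr x hx).2
      simp only [q, hκ0 x hx]
      positivity
    · have := hκpos x hx
      simp only [q]
      positivity
  let B : Fin 3 → Fin 3 → V3 → ℝ := fun i j x => (q x)⁻¹ * crossConj (grad3 f x) (S0 x) i j
  have hB : ∀ i j, ContDiff ℝ (⊤ : ℕ∞) (B i j) := fun i j => by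
    have hS (k l : Fin 3) : ContDiff ℝ (⊤ : ℕ∞) fun x => S0 x k l :=
      contDiff_pi.1 (contDiff_pi.1 hS0smooth k) l
    have h (a b k l : Fin 3) := ((hgrad a).mul (hgrad b)).mul (hS k l)
    exact (hq.inv hq0).mul
      ((((h _ _ _ _).sub (h _ _ _ _)).sub (h _ _ _ _)).add (h _ _ _ _))
  let A : Fin 3 → Fin 3 → V3 → ℝ := fun i j x => f x * (f x * B i j x)
  have hA : ∀ i j, ContDiff ℝ (⊤ : ℕ∞) (A i j) := fun i j => hf.mul (hf.mul (hB i j))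
  have hAsymm : ∀ i j, A i j = A j i := fun i j => by
    funext x
    simp only [A, B, crossConj_symm _ (hS0symm x) i j]
  refine ⟨incompatibility A, contDiff_incompatibility hA, incompatibility_symm hA hAsymm,
    fun x _ => divM_incompatibility hA x, fun x hx => ?_⟩
  funext i j
  have hboundary : incompatibility A x i j =
      2 * crossConj (grad3 f x) (fun k l => B k l x) i j := by
    simp only [incompatibility, A, partialDeriv3_partialDeriv3_sq_mul hf (hB _ _) (hfr x hx).1,
      crossConj]
    simp only [grad3, partialDeriv3]
    ring
  have hpos := hnorm x (hfr x hx).2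
  rw [hboundary, crossConj_smul, crossConj_crossConj _ (hS0symm x) (htan x hx)]
  simp only [q, hκ0 x hx, add_zero]
  field_simp
end
end

section
/- Let {ζ₁, ζ₂, v} be an orthonormal basis of ℝ³. There exist r > 0, unit vectors ζ₃, …, ζ₆ ∈ ℝ³, and smooth functions Γ₁, …, Γ₆ defined on the ball B(Id, r) ⊂ 𝒮³ such that S = Σ_{j=1}^{6} Γ_j(S)² ζ_j ⊗ ζ_j for every S ∈ B(Id, r). Moreover, the angle between v and each of the vectors ζ_j (j = 1, …, 6) lies between 45° and 90°. -/
noncomputable section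

open MeasureTheory Filter Topology

/-- The operator norm of a 3×3 matrix. -/
def matNorm (M : Fin 3 → Fin 3 → ℝ) : ℝ :=
  ⨆ v : V3, if norm3 v ≤ 1 then norm3 (fun i => ∑ j, M i j * v j) else 0

/-- The identity matrix. -/
def idMat : Fin 3 → Fin 3 → ℝ := fun i j => if i = j then 1 else 0

/-- The bilinear form `aᵀ S b` of a matrix `S`. -/
def bilin3 (a b : V3) (S : Fin 3 → Fin 3 → ℝ) : ℝ := ∑ i, ∑ k, a i * S i k * b k

theorem dot3_self_nonneg (a : V3) : 0 ≤ dot3 a a :=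
  Finset.sum_nonneg fun i _ => mul_self_nonneg (a i)

theorem norm3_eq_one_iff (a : V3) : norm3 a = 1 ↔ dot3 a a = 1 := Real.sqrt_eq_one

theorem abs_apply_le_norm3 (a : V3) (i : Fin 3) : |a i| ≤ norm3 a := by
  refine Real.abs_le_sqrt ?_
  rw [sq]
  exact Finset.single_le_sum (f := fun i => a i * a i)
    (fun i _ => mul_self_nonneg (a i)) (Finset.mem_univ i)

theorem norm3_le_sum_abs (a : V3) : norm3 a ≤ ∑ i, |a i| := by
  refine Real.sqrt_le_iff.mpr ⟨Finset.sum_nonneg fun i _ => abs_nonneg _, ?_⟩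
  simp only [dot3, Fin.sum_univ_three]
  nlinarith [abs_mul_abs_self (a 0), abs_mul_abs_self (a 1), abs_mul_abs_self (a 2),
    mul_nonneg (abs_nonneg (a 0)) (abs_nonneg (a 1)),
    mul_nonneg (abs_nonneg (a 0)) (abs_nonneg (a 2)),
    mul_nonneg (abs_nonneg (a 1)) (abs_nonneg (a 2))]

theorem abs_dot3_le (a b : V3) : |dot3 a b| ≤ norm3 a * norm3 b := by
  rw [norm3, norm3, ← Real.sqrt_mul (dot3_self_nonneg a)]
  refine Real.abs_le_sqrt ?_
  simpa only [dot3, ← sq] using Finset.sum_mul_sq_le_sq_mul_sq Finset.univ a b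

theorem norm3_mulVec_le_matNorm (M : Fin 3 → Fin 3 → ℝ) {b : V3} (hb : norm3 b ≤ 1) :
    norm3 (fun i => ∑ j, M i j * b j) ≤ matNorm M := by
  have hbdd : BddAbove (Set.range fun v : V3 =>
      if norm3 v ≤ 1 then norm3 (fun i => ∑ j, M i j * v j) else 0) := by
    refine ⟨∑ i, ∑ j, |M i j|, ?_⟩
    rintro _ ⟨v, rfl⟩
    dsimp only
    split_ifs with hv
    · refine (norm3_le_sum_abs _).trans (Finset.sum_le_sum fun i _ => ?_)
      refine (Finset.abs_sum_le_sum_abs _ _).trans (Finset.sum_le_sum fun j _ => ?_)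
      rw [abs_mul]
      exact mul_le_of_le_one_right (abs_nonneg _) ((abs_apply_le_norm3 v j).trans hv)
    · exact Finset.sum_nonneg fun i _ => Finset.sum_nonneg fun j _ => abs_nonneg _
  simpa [hb, matNorm] using le_ciSup hbdd b

theorem abs_bilin3_le_matNorm (M : Fin 3 → Fin 3 → ℝ) {a b : V3}
    (ha : norm3 a = 1) (hb : norm3 b = 1) : |bilin3 a b M| ≤ matNorm M := by
  have h : bilin3 a b M = dot3 a (fun i => ∑ j, M i j * b j) := by
    simp only [bilin3, dot3, Finset.mul_sum, mul_assoc]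
  rw [h]
  refine (abs_dot3_le _ _).trans ?_
  rw [ha, one_mul]
  exact norm3_mulVec_le_matNorm M hb.le

theorem bilin3_sub_idMat (a b : V3) (S : Fin 3 → Fin 3 → ℝ) :
    bilin3 a b (fun i k => S i k - idMat i k) = bilin3 a b S - dot3 a b := by
  simp only [bilin3, dot3, idMat, Fin.sum_univ_three, Fin.isValue, Fin.reduceEq, if_true, if_false]
  ring

theorem abs_bilin3_sub_dot3_le (S : Fin 3 → Fin 3 → ℝ) {a b : V3}
    (ha : norm3 a = 1) (hb : norm3 b = 1) :
    |bilin3 a b S - dot3 a b| ≤ matNorm (fun i k => S i k - idMat i k) := by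
  rw [← bilin3_sub_idMat]
  exact abs_bilin3_le_matNorm _ ha hb

theorem bilin3_comm {S : Fin 3 → Fin 3 → ℝ} (hS : ∀ i j, S i j = S j i) (a b : V3) :
    bilin3 a b S = bilin3 b a S := by
  rw [bilin3, Finset.sum_comm]
  refine Finset.sum_congr rfl fun i _ => Finset.sum_congr rfl fun k _ => ?_
  rw [hS k i]
  ring

theorem contDiff_bilin3 (a b : V3) {n : WithTop ℕ∞} : ContDiff ℝ n (bilin3 a b) := by
  unfold bilin3
  fun_prop

theorem dot3_comm (a b : V3) : dot3 a b = dot3 b a := by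
  simp only [dot3, mul_comm]

/-- A matrix is recovered from its coefficients in an orthonormal basis. -/
theorem eq_sum_bilin3 (f : Fin 3 → V3)
    (hf : ∀ a b, dot3 (f a) (f b) = if a = b then 1 else 0) (S : Fin 3 → Fin 3 → ℝ)
    (i k : Fin 3) : S i k = ∑ a, ∑ b, bilin3 (f a) (f b) S * f a i * f b k := by
  let M : Matrix (Fin 3) (Fin 3) ℝ := Matrix.of f
  have hM : M * M.transpose = 1 := by
    ext a b
    simpa [M, Matrix.mul_apply, Matrix.one_apply, dot3] using hf a b
  have hM' : M.transpose * M = 1 := mul_eq_one_comm.mp hM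
  have key : Matrix.of S = M.transpose * (M * Matrix.of S * M.transpose) * M := by
    calc Matrix.of S = (M.transpose * M) * Matrix.of S * (M.transpose * M) := by simp [hM']
      _ = _ := by simp only [Matrix.mul_assoc]
  have h := congrFun (congrFun key i) k
  simp only [Matrix.mul_apply, Matrix.of_apply, Matrix.transpose_apply, M,
    Fin.sum_univ_three] at h
  rw [h]
  simp only [bilin3, Fin.sum_univ_three]
  ring

/-- The directions of the decomposition: `a`, `b` and the four vectors
`(± a ± b) / 2 + v / √2`. -/
def decompDir (a b v : V3) : Fin 6 → V3 :=
  ![a, b,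
    fun i => (a i + b i) / 2 + Real.sqrt 2 / 2 * v i,
    fun i => (a i - b i) / 2 + Real.sqrt 2 / 2 * v i,
    fun i => (-a i + b i) / 2 + Real.sqrt 2 / 2 * v i,
    fun i => (-a i - b i) / 2 + Real.sqrt 2 / 2 * v i]

/-- The coefficients of a symmetric matrix along `ζ ⊗ ζ`, for `ζ` in `decompDir a b v`. -/
def decompCoeff (a b v : V3) : Fin 6 → (Fin 3 → Fin 3 → ℝ) → ℝ :=
  ![fun S => bilin3 a a S - bilin3 v v S / 2,
    fun S => bilin3 b b S - bilin3 v v S / 2,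
    fun S => bilin3 v v S / 2 + Real.sqrt 2 / 2 * (bilin3 a v S + bilin3 b v S) + bilin3 a b S,
    fun S => bilin3 v v S / 2 + Real.sqrt 2 / 2 * (bilin3 a v S - bilin3 b v S) - bilin3 a b S,
    fun S => bilin3 v v S / 2 + Real.sqrt 2 / 2 * (-bilin3 a v S + bilin3 b v S) - bilin3 a b S,
    fun S => bilin3 v v S / 2 + Real.sqrt 2 / 2 * (-bilin3 a v S - bilin3 b v S) + bilin3 a b S]

theorem contDiff_decompCoeff (a b v : V3) (j : Fin 6) {n : WithTop ℕ∞} :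
    ContDiff ℝ n (decompCoeff a b v j) := by
  have haa := contDiff_bilin3 a a (n := n)
  have hbb := contDiff_bilin3 b b (n := n)
  have hvv := contDiff_bilin3 v v (n := n)
  have hav := contDiff_bilin3 a v (n := n)
  have hbv := contDiff_bilin3 b v (n := n)
  have hab := contDiff_bilin3 a b (n := n)
  fin_cases j <;>
    simp only [decompCoeff, Fin.zero_eta, Fin.mk_one, Fin.reduceFinMk, Matrix.cons_val_zero,
      Matrix.cons_val_one, Matrix.cons_val] <;> fun_prop

theorem decompCoeff_pos {a b v : V3} (ha : norm3 a = 1) (hb : norm3 b = 1) (hv : norm3 v = 1)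
    (hab : dot3 a b = 0) (hav : dot3 a v = 0) (hbv : dot3 b v = 0)
    {S : Fin 3 → Fin 3 → ℝ}
    (hS : matNorm (fun i k => S i k - idMat i k) < 1 / 10) (j : Fin 6) :
    0 < decompCoeff a b v j S := by
  have haa := abs_le.mp ((abs_bilin3_sub_dot3_le S ha ha).trans hS.le)
  have hbb := abs_le.mp ((abs_bilin3_sub_dot3_le S hb hb).trans hS.le)
  have hvv := abs_le.mp ((abs_bilin3_sub_dot3_le S hv hv).trans hS.le)
  have hav' := abs_le.mp ((abs_bilin3_sub_dot3_le S ha hv).trans hS.le)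
  have hbv' := abs_le.mp ((abs_bilin3_sub_dot3_le S hb hv).trans hS.le)
  have hab' := abs_le.mp ((abs_bilin3_sub_dot3_le S ha hb).trans hS.le)
  rw [(norm3_eq_one_iff a).mp ha] at haa
  rw [(norm3_eq_one_iff b).mp hb] at hbb
  rw [(norm3_eq_one_iff v).mp hv] at hvv
  rw [hav] at hav'
  rw [hbv] at hbv'
  rw [hab] at hab'
  have hs : Real.sqrt 2 / 2 ≤ 1 := by
    have : Real.sqrt 2 ≤ 2 := Real.sqrt_le_iff.mpr (by norm_num)
    linarith
  have hs0 : 0 ≤ Real.sqrt 2 / 2 := by positivity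
  have bound {x : ℝ} (hx : -(2 / 10) ≤ x) : -(2 / 10) ≤ Real.sqrt 2 / 2 * x := by
    nlinarith
  fin_cases j <;>
    simp only [decompCoeff, Fin.zero_eta, Fin.mk_one, Fin.reduceFinMk, Matrix.cons_val_zero,
      Matrix.cons_val_one, Matrix.cons_val]
  · linarith
  · linarith
  · linarith [bound (x := bilin3 a v S + bilin3 b v S) (by linarith)]
  · linarith [bound (x := bilin3 a v S - bilin3 b v S) (by linarith)]
  · linarith [bound (x := -bilin3 a v S + bilin3 b v S) (by linarith)]
  · linarith [bound (x := -bilin3 a v S - bilin3 b v S) (by linarith)]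

theorem norm3_decompDir {a b v : V3} (ha : norm3 a = 1) (hb : norm3 b = 1) (hv : norm3 v = 1)
    (hab : dot3 a b = 0) (hav : dot3 a v = 0) (hbv : dot3 b v = 0)
    (j : Fin 6) : norm3 (decompDir a b v j) = 1 := by
  have hs : Real.sqrt 2 ^ 2 = 2 := Real.sq_sqrt (by norm_num)
  rw [norm3_eq_one_iff] at *
  simp only [dot3, Fin.sum_univ_three] at *
  fin_cases j <;>
    simp only [decompDir, Fin.zero_eta, Fin.mk_one, Fin.reduceFinMk, Matrix.cons_val_zero,
      Matrix.cons_val_one, Matrix.cons_val]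
  · exact ha
  · exact hb
  · linear_combination ha / 4 + hb / 4 + Real.sqrt 2 ^ 2 / 4 * hv + hs / 4 +
      hab / 2 + Real.sqrt 2 / 2 * hav + Real.sqrt 2 / 2 * hbv
  · linear_combination ha / 4 + hb / 4 + Real.sqrt 2 ^ 2 / 4 * hv + hs / 4 -
      hab / 2 + Real.sqrt 2 / 2 * hav - Real.sqrt 2 / 2 * hbv
  · linear_combination ha / 4 + hb / 4 + Real.sqrt 2 ^ 2 / 4 * hv + hs / 4 -
      hab / 2 - Real.sqrt 2 / 2 * hav + Real.sqrt 2 / 2 * hbv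
  · linear_combination ha / 4 + hb / 4 + Real.sqrt 2 ^ 2 / 4 * hv + hs / 4 +
      hab / 2 - Real.sqrt 2 / 2 * hav - Real.sqrt 2 / 2 * hbv

theorem dot3_decompDir {a b v : V3} (hv : norm3 v = 1)
    (hav : dot3 a v = 0) (hbv : dot3 b v = 0) (j : Fin 6) :
    dot3 v (decompDir a b v j) = 0 ∨ dot3 v (decompDir a b v j) = Real.sqrt 2 / 2 := by
  rw [norm3_eq_one_iff] at hv
  simp only [dot3, Fin.sum_univ_three] at *
  fin_cases j <;>
    simp only [decompDir, Fin.zero_eta, Fin.mk_one, Fin.reduceFinMk, Matrix.cons_val_zero,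
      Matrix.cons_val_one, Matrix.cons_val]
  · left; linear_combination hav
  · left; linear_combination hbv
  · right; linear_combination Real.sqrt 2 / 2 * hv + hav / 2 + hbv / 2
  · right; linear_combination Real.sqrt 2 / 2 * hv + hav / 2 - hbv / 2
  · right; linear_combination Real.sqrt 2 / 2 * hv - hav / 2 + hbv / 2
  · right; linear_combination Real.sqrt 2 / 2 * hv - hav / 2 - hbv / 2

theorem eq_sum_decompCoeff {a b v : V3} (ha : norm3 a = 1) (hb : norm3 b = 1) (hv : norm3 v = 1)
    (hab : dot3 a b = 0) (hav : dot3 a v = 0) (hbv : dot3 b v = 0)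
    {S : Fin 3 → Fin 3 → ℝ} (hS : ∀ i j, S i j = S j i) (i k : Fin 3) :
    S i k = ∑ j, decompCoeff a b v j S * decompDir a b v j i * decompDir a b v j k := by
  have hs : Real.sqrt 2 ^ 2 = 2 := Real.sq_sqrt (by norm_num)
  rw [norm3_eq_one_iff] at ha hb hv
  have h := eq_sum_bilin3 ![a, b, v] (by
    intro x y
    fin_cases x <;> fin_cases y <;>
      simp [ha, hb, hv, hab, hav, hbv, dot3_comm b a, dot3_comm v a, dot3_comm v b]) S i k
  simp only [Fin.sum_univ_three, Matrix.cons_val_zero, Matrix.cons_val_one, Matrix.cons_val,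
    bilin3_comm hS b a, bilin3_comm hS v a, bilin3_comm hS v b] at h
  rw [h]
  simp only [Fin.sum_univ_six, decompCoeff, decompDir, Matrix.cons_val_zero, Matrix.cons_val_one,
    Matrix.cons_val]
  ring_nf
  simp only [hs]
  ring

/-- **Lemma A.2 (geometric decomposition of symmetric matrices).** Given an orthonormal basis
`{ζ₁, ζ₂, v}` of `ℝ³`, there are `r > 0`, unit vectors `ζ₃, …, ζ₆` and smooth functions
`Γ₁, …, Γ₆` on the ball `B(Id, r) ⊂ 𝒮³` such that `S = Σ_{j=1}^6 Γ_j(S)² ζ_j ⊗ ζ_j` for every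
symmetric `S` in the ball; moreover the angle between `v` and each `ζ_j` lies between
`45°` and `90°` (i.e. `0 ≤ v·ζ_j ≤ √2/2`). -/
theorem geometric_decomposition_lemma
    (ζ1 ζ2 v : V3)
    (h1 : norm3 ζ1 = 1) (h2 : norm3 ζ2 = 1) (hv : norm3 v = 1)
    (h12 : dot3 ζ1 ζ2 = 0) (h1v : dot3 ζ1 v = 0) (h2v : dot3 ζ2 v = 0) :
    ∃ r : ℝ, 0 < r ∧
    ∃ ζ : Fin 6 → V3, ζ 0 = ζ1 ∧ ζ 1 = ζ2 ∧ (∀ j, norm3 (ζ j) = 1) ∧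
    ∃ Γ : Fin 6 → (Fin 3 → Fin 3 → ℝ) → ℝ,
      (∀ j, ContDiffOn ℝ (⊤ : ℕ∞) (Γ j) {S | matNorm (fun i k => S i k - idMat i k) < r}) ∧
      (∀ S : Fin 3 → Fin 3 → ℝ, (∀ i j, S i j = S j i) →
        matNorm (fun i k => S i k - idMat i k) < r →
        ∀ i k, S i k = ∑ j : Fin 6, (Γ j S) ^ 2 * ζ j i * ζ j k) ∧
      (∀ j, 0 ≤ dot3 v (ζ j) ∧ dot3 v (ζ j) ≤ Real.sqrt 2 / 2) := by
  refine ⟨1 / 10, by norm_num, decompDir ζ1 ζ2 v, rfl, rfl,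
    norm3_decompDir h1 h2 hv h12 h1v h2v, fun j S => Real.sqrt (decompCoeff ζ1 ζ2 v j S),
    fun j => ?_, fun S hS hr i k => ?_, fun j => ?_⟩
  · exact (contDiff_decompCoeff ζ1 ζ2 v j).contDiffOn.sqrt fun S hS =>
      (decompCoeff_pos h1 h2 hv h12 h1v h2v hS j).ne'
  · simp only [Real.sq_sqrt (decompCoeff_pos h1 h2 hv h12 h1v h2v hr _).le]
    exact eq_sum_decompCoeff h1 h2 hv h12 h1v h2v hS i k
  · rcases dot3_decompDir hv h1v h2v j with h | h <;> rw [h]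
    · exact ⟨le_rfl, by positivity⟩
    · exact ⟨by positivity, le_rfl⟩
end
end

section
/- Let Ω ⊂ ℝ³ be a bounded domain with smooth boundary, let α ∈ (0,1), and let r > 0 be sufficiently small (depending on Ω). Then every f ∈ C_c^∞(ℝ³) supported in the collar {x ∈ ℝ³ : 0 < dist(x, Ω) < r} satisfies ‖f‖_{B^{−1+α}_{∞,∞}} ≤ C(Ω, α) r^{1−α} ‖f‖₀. -/
noncomputable section

open MeasureTheory Filter Topology

/-! ### Fourier transform and Littlewood–Paley/Besov norms on ℝ³ -/

/-- Fourier transform on `ℝ³`. -/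
def ftr (f : V3 → ℂ) : V3 → ℂ :=
  fun ξ => ∫ x : V3, Complex.exp (-(2 * Real.pi * Complex.I) * (dot3 x ξ : ℂ)) * f x

/-- Inverse Fourier transform on `ℝ³`. -/
def iftr (g : V3 → ℂ) : V3 → ℂ :=
  fun x => ∫ ξ : V3, Complex.exp ((2 * Real.pi * Complex.I) * (dot3 x ξ : ℂ)) * g ξ

/-- The Fourier multiplier `m(D)` applied to `f`. -/
def fmult (m : V3 → ℝ) (f : V3 → ℂ) : V3 → ℂ :=
  iftr fun ξ => (m ξ : ℂ) * ftr f ξ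

/-- A Littlewood–Paley pair `(χ, φ)`: smooth radial functions valued in `[0,1]` with
`supp χ ⊆ B(0,4/3)`, `supp φ ⊆ {3/4 < |ξ| < 8/3}`, and `χ(ξ) + Σ_{N≥0} φ(2^{-N}ξ) = 1`. -/
structure LPpair (χ φ : V3 → ℝ) : Prop where
  smooth : ContDiff ℝ (⊤ : ℕ∞) χ
  smooth' : ContDiff ℝ (⊤ : ℕ∞) φ
  radial : ∀ ξ ξ' : V3, norm3 ξ = norm3 ξ' → χ ξ = χ ξ'
  radial' : ∀ ξ ξ' : V3, norm3 ξ = norm3 ξ' → φ ξ = φ ξ'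
  range01 : ∀ ξ, 0 ≤ χ ξ ∧ χ ξ ≤ 1
  range01' : ∀ ξ, 0 ≤ φ ξ ∧ φ ξ ≤ 1
  suppLow : ∀ ξ : V3, ¬ norm3 ξ < 4/3 → χ ξ = 0
  suppAnn : ∀ ξ : V3, ¬ (3/4 < norm3 ξ ∧ norm3 ξ < 8/3) → φ ξ = 0
  partition : ∀ ξ : V3, χ ξ + ∑' N : ℕ, φ ((2:ℝ) ^ (-(N:ℤ)) • ξ) = 1

/-- Low-frequency projector `P_< = χ(D)`. -/
def lowProj (χ : V3 → ℝ) (f : V3 → ℂ) : V3 → ℂ := fmult χ f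

/-- Dyadic block `P_N = φ(2^{-N} D)`. -/
def dyadProj (φ : V3 → ℝ) (N : ℕ) (f : V3 → ℂ) : V3 → ℂ :=
  fmult (fun ξ => φ ((2:ℝ) ^ (-(N:ℤ)) • ξ)) f

/-- The Besov `B^s_{∞,∞}` norm associated with a Littlewood–Paley pair `(χ, φ)`:
`‖h‖ = ‖P_< h‖₀ + sup_{N ≥ 0} 2^{Ns} ‖P_N h‖₀`. -/
def BesovNorm (χ φ : V3 → ℝ) (s : ℝ) (f : V3 → ℂ) : ℝ :=
  C0Norm (lowProj χ f) + ⨆ N : ℕ, (2:ℝ) ^ ((N:ℝ) * s) * C0Norm (dyadProj φ N f)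

/-- Besov norm of a real-valued function. -/
def BesovNormR (χ φ : V3 → ℝ) (s : ℝ) (f : V3 → ℝ) : ℝ :=
  BesovNorm χ φ s (fun x => (f x : ℂ))

/-- Euclidean distance from a point to a set. -/
def infDist3 (x : V3) (s : Set V3) : ℝ := ⨅ y : s, norm3 (x - (y : V3))

lemma norm_le_norm3 (v : V3) : ‖v‖ ≤ norm3 v := by
  refine (pi_norm_le_iff_of_nonneg (Real.sqrt_nonneg _)).2 fun i => ?_
  refine Real.le_sqrt_of_sq_le ?_
  rw [Real.norm_eq_abs, sq_abs, sq]
  exact Finset.single_le_sum (f := fun j => v j * v j) (fun j _ => mul_self_nonneg _)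
    (Finset.mem_univ i)

/-- A point outside an open set is at least as close to the frontier as to any given point of the
set. -/
lemma exists_mem_frontier_norm_sub_le {E : Type*} [NormedAddCommGroup E] [NormedSpace ℝ E]
    {Ω : Set E} (hΩ : IsOpen Ω) {y z : E} (hz : z ∈ Ω) (hy : y ∉ Ω) :
    ∃ q ∈ frontier Ω, ‖y - q‖ ≤ ‖y - z‖ := by
  by_contra! hcon
  have hseg : ∀ q ∈ segment ℝ z y, q ∉ frontier Ω := by
    intro q hq hqf
    refine (hcon q hqf).not_ge ?_
    rw [← dist_eq_norm, ← dist_eq_norm, dist_comm y q, dist_comm y z]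
    linarith [dist_add_dist_of_mem_segment hq, dist_nonneg (x := z) (y := q)]
  have hsub : segment ℝ z y ⊆ Ω ∪ (closure Ω)ᶜ := by
    intro q hq
    by_contra hqn
    simp only [Set.mem_union, Set.mem_compl_iff, not_or, not_not] at hqn
    exact hseg q hq ⟨hqn.2, by rw [hΩ.interior_eq]; exact hqn.1⟩
  have hdisj : Disjoint Ω (closure Ω)ᶜ :=
    Set.disjoint_compl_right_iff_subset.2 subset_closure
  have := (convex_segment (𝕜 := ℝ) z y).isPreconnected.subset_left_of_subset_union hΩ
    isClosed_closure.isOpen_compl hdisj hsub ⟨z, left_mem_segment ℝ z y, hz⟩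
  exact hy (this (right_mem_segment ℝ z y))

lemma exists_mem_frontier_of_mem_collar {Ω : Set V3} (hΩ : IsOpen Ω) (hne : Ω.Nonempty)
    {r : ℝ} {y : V3} (hy0 : 0 < infDist3 y Ω) (hyr : infDist3 y Ω < r) :
    ∃ q ∈ frontier Ω, ‖y - q‖ < r := by
  have := hne.to_subtype
  have hyΩ : y ∉ Ω := by
    intro hy
    have hbdd : BddBelow (Set.range fun z : Ω => norm3 (y - (z : V3))) :=
      ⟨0, by rintro _ ⟨z, rfl⟩; exact Real.sqrt_nonneg _⟩
    have h := ciInf_le hbdd ⟨y, hy⟩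
    have h0 : norm3 (y - y) = 0 := by simp [norm3, dot3]
    rw [h0] at h
    exact hy0.not_ge h
  obtain ⟨z, hz⟩ := exists_lt_of_ciInf_lt hyr
  obtain ⟨q, hq, hqz⟩ := exists_mem_frontier_norm_sub_le hΩ z.2 hyΩ
  exact ⟨q, hq, hqz.trans_lt ((norm_le_norm3 _).trans_lt hz)⟩

/-- Near a zero of a differentiable function where its `i`-th partial derivative does not vanish,
the `r`-neighbourhood of the zero set has slices of diameter `O(r)` in the direction `e_i`. -/
lemma exists_slice_bound_of_hasStrictFDerivAt {g : V3 → ℝ} {g' : V3 →L[ℝ] ℝ} {p : V3} {i : Fin 3}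
    (hg : HasStrictFDerivAt g g' p) (hi : g' (e3 i) ≠ 0) :
    ∃ ε > 0, ∃ C > 0, ∀ r : ℝ, ∀ y s, ∀ q ∈ Metric.ball p ε, ∀ q' ∈ Metric.ball p ε,
      g q = 0 → g q' = 0 → y ∈ Metric.ball p ε → y + s • e3 i ∈ Metric.ball p ε →
      ‖y - q‖ ≤ r → ‖y + s • e3 i - q'‖ ≤ r → |s| ≤ C * r := by
  set a := |g' (e3 i)| with ha
  have ha0 : 0 < a := abs_pos.2 hi
  have he : ‖e3 i‖ ≤ 1 := by
    refine (pi_norm_le_iff_of_nonneg zero_le_one).2 fun j => ?_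
    unfold e3; split_ifs <;> simp
  have hev := hg.isLittleO.def (half_pos ha0)
  rw [Metric.eventually_nhds_iff_ball] at hev
  obtain ⟨ε, hε, hball⟩ := hev
  have hstrict : ∀ x ∈ Metric.ball p ε, ∀ x' ∈ Metric.ball p ε,
      |g x - g x' - g' (x - x')| ≤ a / 2 * ‖x - x'‖ := by
    intro x hx x' hx'
    have := hball (x, x') (by rw [← ball_prod_same]; exact ⟨hx, hx'⟩)
    simpa using this
  have hlip : ∀ x ∈ Metric.ball p ε, ∀ q ∈ Metric.ball p ε, ∀ r, g q = 0 → ‖x - q‖ ≤ r →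
      |g x| ≤ (‖g'‖ + a / 2) * r := by
    intro x hx q hq r h0 hr
    have h1 := hstrict x hx q hq
    have h2 : |g' (x - q)| ≤ ‖g'‖ * ‖x - q‖ := g'.le_opNorm _
    rw [h0, sub_zero] at h1
    calc |g x| = |(g x - g' (x - q)) + g' (x - q)| := by ring_nf
      _ ≤ |g x - g' (x - q)| + |g' (x - q)| := abs_add_le _ _
      _ ≤ (‖g'‖ + a / 2) * ‖x - q‖ := by linarith
      _ ≤ _ := by gcongr
  refine ⟨ε, hε, 4 * (‖g'‖ + a / 2) / a, by positivity, ?_⟩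
  intro r y s q hq q' hq' h0 h0' hy hy' hr hr'
  have h1 := hlip y hy q hq r h0 hr
  have h2 := hlip _ hy' q' hq' r h0' hr'
  have h3 := hstrict _ hy' y hy
  rw [add_sub_cancel_left, map_smul, smul_eq_mul, norm_smul, Real.norm_eq_abs] at h3
  have h4 : |s * g' (e3 i)| = |s| * a := abs_mul _ _
  have h5 : a / 2 * (|s| * ‖e3 i‖) ≤ a / 2 * |s| := by
    gcongr
    exact mul_le_of_le_one_right (abs_nonneg _) he
  have h6 : |s| * a ≤ 4 * ((‖g'‖ + a / 2) * r) := by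
    rw [← h4]
    have h7 : |s * g' (e3 i)| ≤
      |g (y + s • e3 i) - g y - s * g' (e3 i)| + (|g (y + s • e3 i)| + |g y|) := by
      calc |s * g' (e3 i)| = |-(g (y + s • e3 i) - g y - s * g' (e3 i))
            + (g (y + s • e3 i) - g y)| := by ring_nf
        _ ≤ |-(g (y + s • e3 i) - g y - s * g' (e3 i))| + |g (y + s • e3 i) - g y| :=
            abs_add_le _ _
        _ ≤ _ := by
            rw [abs_neg]
            gcongr
            exact abs_sub _ _
    linarith
  calc |s| = |s| * a / a := by field_simp
    _ ≤ 4 * ((‖g'‖ + a / 2) * r) / a := by gcongr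
    _ = _ := by ring

/-- A set whose intersection with every line in the direction `e_i` has diameter at most `D`. -/
def SlicesLE (i : Fin 3) (D : ℝ) (S : Set V3) : Prop :=
  ∀ y ∈ S, ∀ s : ℝ, y + s • e3 i ∈ S → |s| ≤ D

/-- A thin collar of a smooth bounded domain is covered by finitely many open sets in each of
which it has slices of diameter `O(r)` in some coordinate direction. -/
lemma SmoothDomain.exists_cover_collar {Ω : Set V3} (hΩ : SmoothDomain Ω) :
    ∃ r₀ > 0, ∃ C > 0, ∃ t : Finset V3, ∃ U : V3 → Set V3, ∃ i : V3 → Fin 3,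
      (∀ p, IsOpen (U p)) ∧ ∀ r, 0 < r → r ≤ r₀ →
      {x : V3 | 0 < infDist3 x Ω ∧ infDist3 x Ω < r} ⊆ ⋃ p ∈ t, U p ∧
      ∀ p ∈ t, SlicesLE (i p) (C * r)
        ({x : V3 | 0 < infDist3 x Ω ∧ infDist3 x Ω < r} ∩ U p) := by
  obtain ⟨g, hg, -, hgrad⟩ := hΩ.defFun
  have hloc : ∀ p : V3, ∃ i : Fin 3, ∃ ε > 0, ∃ C > 0, p ∈ frontier Ω →
      ∀ r : ℝ, ∀ y s, ∀ q ∈ Metric.ball p ε, ∀ q' ∈ Metric.ball p ε,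
      g q = 0 → g q' = 0 → y ∈ Metric.ball p ε → y + s • e3 i ∈ Metric.ball p ε →
      ‖y - q‖ ≤ r → ‖y + s • e3 i - q'‖ ≤ r → |s| ≤ C * r := by
    intro p
    by_cases hp : p ∈ frontier Ω
    · obtain ⟨i, hi⟩ := Function.ne_iff.1 (hgrad p hp).2
      obtain ⟨ε, hε, C, hC, h⟩ := exists_slice_bound_of_hasStrictFDerivAt
        (hg.contDiffAt.hasStrictFDerivAt (by simp)) (i := i) hi
      exact ⟨i, ε, hε, C, hC, fun _ => h⟩
    · exact ⟨0, 1, one_pos, 1, one_pos, fun h => absurd h hp⟩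
  choose i ε hε C hC hslice using hloc
  have hcomp : IsCompact (frontier Ω) :=
    Metric.isCompact_of_isClosed_isBounded isClosed_frontier
      (hΩ.bounded.closure.subset frontier_subset_closure)
  obtain ⟨t, htΩ, ht⟩ := hcomp.elim_nhds_subcover (fun p => Metric.ball p (ε p / 2))
    fun p _ => Metric.ball_mem_nhds p (half_pos (hε p))
  obtain ⟨r₀, hr₀, hr₀t⟩ : ∃ r₀ > 0, ∀ p ∈ t, r₀ ≤ ε p / 4 := by
    have hev : ∀ᶠ r : ℝ in 𝓝[>] 0, ∀ p ∈ t, r ≤ ε p / 4 :=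
      (Filter.eventually_all_finset t).2 fun p _ =>
        nhdsWithin_le_nhds (Iic_mem_nhds (by linarith [hε p]))
    obtain ⟨r, hr, hr'⟩ := (hev.and self_mem_nhdsWithin).exists
    exact ⟨r, hr', hr⟩
  refine ⟨r₀, hr₀, 1 + ∑ p ∈ t, C p, ?_, t, fun p => Metric.ball p (3 * ε p / 4), i,
    fun p => Metric.isOpen_ball, fun r hr hrr => ⟨?_, ?_⟩⟩
  · have := Finset.sum_nonneg fun p (_ : p ∈ t) => (hC p).le
    linarith
  · rintro y ⟨hy0, hyr⟩
    obtain ⟨q, hq, hqy⟩ := exists_mem_frontier_of_mem_collar hΩ.isOpen hΩ.nonempty hy0 hyr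
    obtain ⟨p, hp, hqp⟩ := Set.mem_iUnion₂.1 (ht hq)
    refine Set.mem_iUnion₂.2 ⟨p, hp, ?_⟩
    rw [Metric.mem_ball] at hqp ⊢
    rw [← dist_eq_norm] at hqy
    linarith [dist_triangle y q p, hr₀t p hp]
  · rintro p hp y ⟨⟨hy0, hyr⟩, hyp⟩ s ⟨⟨hz0, hzr⟩, hzp⟩
    obtain ⟨q, hq, hqy⟩ := exists_mem_frontier_of_mem_collar hΩ.isOpen hΩ.nonempty hy0 hyr
    obtain ⟨q', hq', hqy'⟩ := exists_mem_frontier_of_mem_collar hΩ.isOpen hΩ.nonempty hz0 hzr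
    have hmem : ∀ x x', dist x p < 3 * ε p / 4 → ‖x - x'‖ < r → x' ∈ Metric.ball p (ε p) := by
      intro x x' h h'
      rw [← dist_eq_norm, dist_comm] at h'
      rw [Metric.mem_ball]
      linarith [dist_triangle x' x p, hr₀t p hp]
    have hsub : Metric.ball p (3 * ε p / 4) ⊆ Metric.ball p (ε p) :=
      Metric.ball_subset_ball (by linarith [hε p])
    have h := hslice p (htΩ p hp) r y s q (hmem y q hyp hqy) q' (hmem _ q' hzp hqy')
      (hgrad q hq).1 (hgrad q' hq').1 (hsub hyp) (hsub hzp) hqy.le hqy'.le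
    have hsum := Finset.single_le_sum (f := C) (fun p _ => (hC p).le) hp
    refine h.trans ?_
    gcongr
    linarith

/-- The Cauchy weight `u ↦ l / (1 + (l u)²)`, of integral `π`. -/
def cauchyWeight (l u : ℝ) : ℝ := l * (1 + (l * u) ^ 2)⁻¹

lemma cauchyWeight_nonneg {l : ℝ} (hl : 0 ≤ l) (u : ℝ) : 0 ≤ cauchyWeight l u := by
  unfold cauchyWeight; positivity

lemma cauchyWeight_le {l : ℝ} (hl : 0 ≤ l) (u : ℝ) : cauchyWeight l u ≤ l :=
  mul_le_of_le_one_right hl (inv_le_one_of_one_le₀ (by nlinarith [sq_nonneg (l * u)]))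

lemma continuous_cauchyWeight (l : ℝ) : Continuous (cauchyWeight l) := by
  unfold cauchyWeight
  exact continuous_const.mul (Continuous.inv₀ (by fun_prop) fun u => by positivity)

lemma integrable_cauchyWeight_sub {l : ℝ} (hl : 0 < l) (x : ℝ) :
    Integrable fun u => cauchyWeight l (x - u) :=
  ((integrable_inv_one_add_sq.comp_mul_left' hl.ne').const_mul l).comp_sub_left x

lemma integral_cauchyWeight_sub {l : ℝ} (hl : 0 < l) (x : ℝ) :
    ∫ u, cauchyWeight l (x - u) = Real.pi := by
  rw [integral_sub_left_eq_self (cauchyWeight l) volume x]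
  unfold cauchyWeight
  rw [integral_const_mul, Measure.integral_comp_mul_left fun u => (1 + u ^ 2)⁻¹,
    integral_univ_inv_one_add_sq, abs_of_pos (inv_pos.2 hl), smul_eq_mul]
  field_simp

lemma lintegral_prod_cauchyWeight {n : ℕ} {l : ℝ} (hl : 0 < l) (x : Fin n → ℝ) :
    ∫⁻ y : Fin n → ℝ, ENNReal.ofReal (∏ j, cauchyWeight l (x j - y j)) =
      ENNReal.ofReal (Real.pi ^ n) := by
  rw [← ofReal_integral_eq_lintegral_ofReal]
  · rw [integral_fintype_prod_volume_eq_prod fun j u => cauchyWeight l (x j - u)]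
    simp [integral_cauchyWeight_sub hl]
  · exact Integrable.fintype_prod fun j => integrable_cauchyWeight_sub hl (x j)
  · exact Eventually.of_forall fun y => Finset.prod_nonneg fun j _ => cauchyWeight_nonneg hl.le _

lemma SlicesLE.mono {i : Fin 3} {D : ℝ} {S T : Set V3} (hT : SlicesLE i D T) (h : S ⊆ T) :
    SlicesLE i D S :=
  fun y hy s hs => hT y (h hy) s (h hs)

lemma SlicesLE.volume_preimage_insertNth_le {i : Fin 3} {D : ℝ} {S : Set V3}
    (hS : SlicesLE i D S) (y : Fin 2 → ℝ) :
    volume {t : ℝ | i.insertNth t y ∈ S} ≤ ENNReal.ofReal D := by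
  refine (Real.volume_le_diam _).trans (Metric.ediam_le fun t ht t' ht' => ?_)
  rw [edist_dist, Real.dist_eq]
  refine ENNReal.ofReal_le_ofReal (hS (i.insertNth t' y) ht' _ ?_)
  have heq : (i.insertNth t' y + (t - t') • e3 i : V3) = i.insertNth t y := by
    refine (Fin.insertNth_eq_iff).2 ⟨?_, ?_⟩ |>.symm
    · simp [e3]
    · ext j
      simp [e3, Fin.removeNth, Fin.succAbove_ne]
  rw [heq]
  exact ht

lemma SlicesLE.setLIntegral_prod_cauchyWeight_le {i : Fin 3} {D : ℝ} {S : Set V3}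
    (hS : SlicesLE i D S) (hD : 0 ≤ D) (hSm : MeasurableSet S) {l : ℝ} (hl : 0 < l) (x : V3) :
    ∫⁻ y in S, ENNReal.ofReal (∏ j, cauchyWeight l (x j - y j)) ≤
      ENNReal.ofReal (l * D * Real.pi ^ 2) := by
  have hmeas : Measurable fun y : V3 => ENNReal.ofReal (∏ j, cauchyWeight l (x j - y j)) := by
    refine ENNReal.measurable_ofReal.comp (Continuous.measurable ?_)
    exact continuous_finsetProd _ fun j _ => (continuous_cauchyWeight l).comp (by fun_prop)
  have e := (volume_preserving_piFinSuccAbove (fun _ : Fin 3 => ℝ) i).symm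
  rw [← lintegral_indicator hSm, ← e.lintegral_comp (hmeas.indicator hSm)]
  refine (lintegral_prod_symm _
    ((hmeas.indicator hSm).comp e.measurable).aemeasurable).trans_le ?_
  calc _ ≤ ∫⁻ y : Fin 2 → ℝ, ENNReal.ofReal (l * D) *
        ENNReal.ofReal (∏ j, cauchyWeight l (x (i.succAbove j) - y j)) := by
        refine lintegral_mono fun y => ?_
        set P := ∏ j, cauchyWeight l (x (i.succAbove j) - y j) with hP
        have hP0 : 0 ≤ P := Finset.prod_nonneg fun j _ => cauchyWeight_nonneg hl.le _
        have hmS : MeasurableSet {t : ℝ | i.insertNth t y ∈ S} :=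
          (Continuous.finInsertNth (A := fun _ => ℝ) i continuous_id
            continuous_const).measurable hSm
        calc _ ≤ ∫⁻ t : ℝ, {t : ℝ | i.insertNth t y ∈ S}.indicator
              (fun _ => ENNReal.ofReal (l * P)) t := by
              refine lintegral_mono fun t => ?_
              by_cases ht : (i.insertNth t y : V3) ∈ S
              · have ht' : t ∈ {t : ℝ | i.insertNth t y ∈ S} := ht
                rw [Set.indicator_of_mem ht']
                refine (Set.indicator_le_self _ _ _).trans (ENNReal.ofReal_le_ofReal ?_)
                rw [Fin.prod_univ_succAbove _ i]
                have := cauchyWeight_le hl.le (x i - t)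
                simpa [hP] using mul_le_mul_of_nonneg_right this hP0
              · have h0 : S.indicator (fun y : V3 =>
                    ENNReal.ofReal (∏ j, cauchyWeight l (x j - y j))) (i.insertNth t y) = 0 :=
                  Set.indicator_of_notMem ht _
                exact h0.trans_le zero_le
          _ = ENNReal.ofReal (l * P) * volume {t : ℝ | i.insertNth t y ∈ S} := by
              rw [lintegral_indicator hmS, setLIntegral_const]
          _ ≤ ENNReal.ofReal (l * P) * ENNReal.ofReal D := by
              gcongr
              exact hS.volume_preimage_insertNth_le y
          _ = _ := by
              rw [← ENNReal.ofReal_mul (by positivity), ← ENNReal.ofReal_mul (by positivity)]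
              ring_nf
    _ = _ := by
        rw [lintegral_const_mul' _ _ ENNReal.ofReal_ne_top,
          lintegral_prod_cauchyWeight hl fun j => x (i.succAbove j),
          ← ENNReal.ofReal_mul (by positivity)]

lemma exists_norm_iftr_le {ψ : V3 → ℝ} (hψ : ContDiff ℝ (⊤ : ℕ∞) ψ) (hc : HasCompactSupport ψ) :
    ∃ A > 0, ∀ z : V3, ‖iftr (fun ξ => (ψ ξ : ℂ)) z‖ ≤ A * ∏ j, (1 + z j ^ 2)⁻¹ := by
  let L : EuclideanSpace ℝ (Fin 3) ≃L[ℝ] V3 := EuclideanSpace.equiv (Fin 3) ℝ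
  have hg : ContDiff ℝ (⊤ : ℕ∞) fun ξ : EuclideanSpace ℝ (Fin 3) => (ψ (L ξ) : ℂ) :=
    Complex.ofRealCLM.contDiff.comp (hψ.comp L.contDiff)
  have hgc : HasCompactSupport fun ξ : EuclideanSpace ℝ (Fin 3) => (ψ (L ξ) : ℂ) :=
    (hc.comp_homeomorph L.toHomeomorph).comp_left (g := Complex.ofReal) Complex.ofReal_zero
  let G := FourierTransform.fourierInv (hgc.toSchwartzMap hg)
  have hG : ∀ z : V3, iftr (fun ξ => (ψ ξ : ℂ)) z = G (L.symm z) := by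
    intro z
    have h1 : G (L.symm z) = FourierTransform.fourierInv
        (fun ξ : EuclideanSpace ℝ (Fin 3) => (ψ (L ξ) : ℂ)) (L.symm z) := by
      change (FourierTransform.fourierInv (hgc.toSchwartzMap hg) :
        SchwartzMap (EuclideanSpace ℝ (Fin 3)) ℂ) (L.symm z) = _
      rw [SchwartzMap.fourierInv_coe]
      rfl
    rw [h1, Real.fourierInv_eq', iftr, ← (PiLp.volume_preserving_ofLp (Fin 3)).integral_comp
      (MeasurableEquiv.toLp 2 (Fin 3 → ℝ)).symm.measurableEmbedding]
    refine integral_congr_ae (Eventually.of_forall fun ξ => ?_)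
    have : inner ℝ ξ (L.symm z) = dot3 z ξ.ofLp := by
      simp [PiLp.inner_apply, dot3, L]
    simp only [this, smul_eq_mul]
    congr 2
    push_cast
    ring
  obtain ⟨C, hC⟩ : ∃ C : ℕ → ℝ, ∀ k, 0 < C k ∧ ∀ z, ‖z‖ ^ k * ‖G z‖ ≤ C k := by
    choose C hC using fun k => G.decay k 0
    exact ⟨C, fun k => ⟨(hC k).1, fun z => by simpa using (hC k).2 z⟩⟩
  refine ⟨C 0 + 3 * C 2 + 3 * C 4 + C 6, ?_, fun z => ?_⟩
  · linarith [(hC 0).1, (hC 2).1, (hC 4).1, (hC 6).1]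
  · rw [hG, Finset.prod_inv_distrib, ← div_eq_mul_inv, le_div_iff₀ (by positivity)]
    set N := ‖L.symm z‖
    have hz : ∀ j, z j ^ 2 ≤ N ^ 2 := fun j => by
      have := PiLp.norm_apply_le (L.symm z) j
      rw [← sq_abs (z j)]
      gcongr
      simpa using! this
    calc ‖G (L.symm z)‖ * ∏ j, (1 + z j ^ 2) ≤ ‖G (L.symm z)‖ * ∏ _j : Fin 3, (1 + N ^ 2) := by
          refine mul_le_mul_of_nonneg_left (Finset.prod_le_prod (fun j _ => by positivity)
            fun j _ => ?_) (norm_nonneg _)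
          linarith [hz j]
      _ = N ^ 0 * ‖G (L.symm z)‖ + 3 * (N ^ 2 * ‖G (L.symm z)‖) + 3 * (N ^ 4 * ‖G (L.symm z)‖)
          + N ^ 6 * ‖G (L.symm z)‖ := by
          simp only [Finset.prod_const, Finset.card_univ, Fintype.card_fin]; ring
      _ ≤ _ := by
          gcongr <;> exact (hC _).2 _

lemma norm_iftr_comp_smul_le {ψ : V3 → ℝ} {A : ℝ}
    (hA : ∀ z : V3, ‖iftr (fun ξ => (ψ ξ : ℂ)) z‖ ≤ A * ∏ j, (1 + z j ^ 2)⁻¹)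
    {l : ℝ} (hl : 0 < l) (z : V3) :
    ‖iftr (fun ξ => (ψ (l⁻¹ • ξ) : ℂ)) z‖ ≤ A * ∏ j, cauchyWeight l (z j) := by
  have h : iftr (fun ξ => (ψ (l⁻¹ • ξ) : ℂ)) z = l ^ 3 • iftr (fun ξ => (ψ ξ : ℂ)) (l • z) := by
    have hs := Measure.integral_comp_smul (volume : Measure V3) (fun ξ : V3 =>
      Complex.exp ((2 * Real.pi * Complex.I) * (dot3 (l • z) ξ : ℂ)) * (ψ ξ : ℂ)) l⁻¹
    have hd : ∀ ξ : V3, dot3 (l • z) (l⁻¹ • ξ) = dot3 z ξ := fun ξ => by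
      simp only [dot3, Pi.smul_apply, smul_eq_mul]
      refine Finset.sum_congr rfl fun i _ => ?_
      field_simp
    simp only [hd, Module.finrank_fintype_fun_eq_card, Fintype.card_fin, inv_pow, inv_inv] at hs
    rw [abs_of_pos (by positivity)] at hs
    exact hs
  rw [h, norm_smul, Real.norm_of_nonneg (by positivity)]
  calc l ^ 3 * ‖iftr (fun ξ => (ψ ξ : ℂ)) (l • z)‖
      ≤ l ^ 3 * (A * ∏ j, (1 + (l • z) j ^ 2)⁻¹) := by gcongr; exact hA _
    _ = _ := by
      simp only [cauchyWeight, Finset.prod_mul_distrib, Pi.smul_apply, smul_eq_mul,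
        Finset.prod_const, Finset.card_univ, Fintype.card_fin]
      ring

lemma continuous_dot3 : Continuous fun p : V3 × V3 => dot3 p.1 p.2 := by
  unfold dot3; fun_prop

lemma norm_exp_two_pi_mul_I (t : ℝ) : ‖Complex.exp ((2 * Real.pi * Complex.I) * (t : ℂ))‖ = 1 := by
  rw [show (2 * Real.pi * Complex.I) * (t : ℂ) = ((2 * Real.pi * t : ℝ) : ℂ) * Complex.I by
    push_cast; ring]
  exact Complex.norm_exp_ofReal_mul_I _

/-- A Fourier multiplier acts by convolution against its kernel. -/
lemma fmult_eq_integral_mul_iftr {m : V3 → ℝ} {f : V3 → ℂ}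
    (hm : Integrable fun ξ => (m ξ : ℂ)) (hf : Integrable f) (x : V3) :
    fmult m f x = ∫ y, iftr (fun ξ => (m ξ : ℂ)) (x - y) * f y := by
  have hint : Integrable (Function.uncurry fun ξ y : V3 =>
      Complex.exp ((2 * Real.pi * Complex.I) * (dot3 (x - y) ξ : ℂ)) * ((m ξ : ℂ) * f y))
      (volume.prod volume) := by
    refine (hm.mul_prod hf).bdd_mul (c := 1) ?_ (Eventually.of_forall fun p => ?_)
    · have h1 : Continuous fun p : V3 × V3 => dot3 (x - p.2) p.1 :=
        continuous_dot3.comp (f := fun p : V3 × V3 => (x - p.2, p.1)) (by fun_prop)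
      exact Continuous.aestronglyMeasurable (by fun_prop)
    · exact (norm_exp_two_pi_mul_I _).le
  calc fmult m f x = ∫ ξ, ∫ y, Complex.exp ((2 * Real.pi * Complex.I) * (dot3 (x - y) ξ : ℂ)) *
        ((m ξ : ℂ) * f y) := by
        unfold fmult iftr ftr
        congr 1 with ξ
        beta_reduce
        rw [← integral_const_mul, ← integral_const_mul]
        congr 1 with y
        have : dot3 (x - y) ξ = dot3 x ξ - dot3 y ξ := by
          simp [dot3, sub_mul, Finset.sum_sub_distrib]
        rw [this, Complex.ofReal_sub, mul_sub, sub_eq_add_neg, Complex.exp_add]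
        simp only [neg_mul, mul_assoc, mul_left_comm]
    _ = _ := by
        rw [integral_integral_swap hint]
        congr 1 with y
        rw [iftr, ← integral_mul_const]
        congr 1 with ξ
        ring

lemma norm_le_C0Norm {F : Type*} [NormedAddCommGroup F] {f : V3 → F} (hf : Continuous f)
    (hc : HasCompactSupport f) (x : V3) : ‖f x‖ ≤ C0Norm f :=
  le_ciSup (f := fun x => ‖f x‖) (hf.norm.bddAbove_range_of_hasCompactSupport hc.norm) x

lemma C0Norm_nonneg {F : Type*} [NormedAddCommGroup F] (f : V3 → F) : 0 ≤ C0Norm f :=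
  Real.iSup_nonneg fun _ => norm_nonneg _

/-- The convolution of a bounded function with the kernel of a dilated multiplier is controlled
by the mass of the dilated kernel majorant over the support. -/
lemma enorm_fmult_comp_smul_le {ψ : V3 → ℝ} (hψ : Continuous ψ) (hψc : HasCompactSupport ψ)
    {A : ℝ} (hA0 : 0 ≤ A)
    (hA : ∀ z : V3, ‖iftr (fun ξ => (ψ ξ : ℂ)) z‖ ≤ A * ∏ j, (1 + z j ^ 2)⁻¹)
    {l : ℝ} (hl : 0 < l) {f : V3 → ℝ} (hf : Continuous f) (hfc : HasCompactSupport f) (x : V3) :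
    ‖fmult (fun ξ => ψ (l⁻¹ • ξ)) (fun y => (f y : ℂ)) x‖ₑ ≤ ENNReal.ofReal (A * C0Norm f) *
      ∫⁻ y in tsupport f, ENNReal.ofReal (∏ j, cauchyWeight l (x j - y j)) := by
  have hm : Integrable fun ξ => (ψ (l⁻¹ • ξ) : ℂ) := by
    have h := hψ.integrable_of_hasCompactSupport (μ := volume) hψc
    exact (h.comp_smul (inv_pos.2 hl).ne').ofReal
  have hfi : Integrable fun y => (f y : ℂ) := (hf.integrable_of_hasCompactSupport hfc).ofReal
  rw [fmult_eq_integral_mul_iftr hm hfi]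
  refine (enorm_integral_le_lintegral_enorm _).trans ?_
  rw [← lintegral_const_mul' _ _ ENNReal.ofReal_ne_top,
    ← lintegral_indicator (isClosed_tsupport f).measurableSet]
  refine lintegral_mono fun y => ?_
  by_cases hy : y ∈ tsupport f
  · rw [Set.indicator_of_mem hy, ← ENNReal.ofReal_mul (mul_nonneg hA0 (C0Norm_nonneg f)),
      ← ofReal_norm]
    refine ENNReal.ofReal_le_ofReal ?_
    rw [norm_mul, Complex.norm_real]
    have h1 := norm_iftr_comp_smul_le hA hl (x - y)
    calc _ ≤ (A * ∏ j, cauchyWeight l ((x - y) j)) * C0Norm f :=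
          mul_le_mul h1 (norm_le_C0Norm hf hfc y) (norm_nonneg _) ((norm_nonneg _).trans h1)
      _ = _ := by simp only [Pi.sub_apply]; ring
  · simp [image_eq_zero_of_notMem_tsupport hy]

lemma setLIntegral_biUnion_finset_le {β E : Type*} [MeasurableSpace E] {μ : Measure E}
    (t : Finset β) (s : β → Set E) (F : E → ENNReal) :
    ∫⁻ y in ⋃ p ∈ t, s p, F y ∂μ ≤ ∑ p ∈ t, ∫⁻ y in s p, F y ∂μ := by
  classical
  induction t using Finset.induction_on with
  | empty => simp
  | insert a t ha ih =>
    rw [Finset.set_biUnion_insert, Finset.sum_insert ha]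
    exact (lintegral_union_le _ _ _).trans (add_le_add_right ih _)

/-- `L^∞` bound and thin-support bound for a dilated smooth compactly supported multiplier. -/
lemma exists_norm_fmult_le {ψ : V3 → ℝ} (hψ : ContDiff ℝ (⊤ : ℕ∞) ψ) (hψc : HasCompactSupport ψ) :
    ∃ B > 0, ∀ l > 0, ∀ f : V3 → ℝ, Continuous f → HasCompactSupport f → ∀ x,
      ‖fmult (fun ξ => ψ (l⁻¹ • ξ)) (fun y => (f y : ℂ)) x‖ ≤ B * C0Norm f ∧
      ∀ (t : Finset V3) (U : V3 → Set V3) (i : V3 → Fin 3) (D : ℝ), 0 ≤ D →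
        (∀ p, IsOpen (U p)) → tsupport f ⊆ ⋃ p ∈ t, U p →
        (∀ p ∈ t, SlicesLE (i p) D (tsupport f ∩ U p)) →
        ‖fmult (fun ξ => ψ (l⁻¹ • ξ)) (fun y => (f y : ℂ)) x‖ ≤
          B * C0Norm f * (t.card * (l * D)) := by
  obtain ⟨A, hA0, hA⟩ := exists_norm_iftr_le hψ hψc
  have hpi := Real.pi_pos
  refine ⟨A * Real.pi ^ 2 * (1 + Real.pi), by positivity, fun l hl f hf hfc x => ⟨?_, ?_⟩⟩
  · have hM := C0Norm_nonneg f
    have h := enorm_fmult_comp_smul_le hψ.continuous hψc hA0.le hA hl hf hfc x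
    have h2 := h.trans (mul_le_mul_right (setLIntegral_le_lintegral _ _) _)
    rw [lintegral_prod_cauchyWeight hl, ← ENNReal.ofReal_mul (by positivity), ← ofReal_norm,
      ENNReal.ofReal_le_ofReal_iff (by positivity)] at h2
    refine h2.trans ?_
    have : 0 ≤ A * C0Norm f * Real.pi ^ 2 := by positivity
    linarith
  · intro t U i D hD hU hcov hsl
    have hM := C0Norm_nonneg f
    have h := enorm_fmult_comp_smul_le hψ.continuous hψc hA0.le hA hl hf hfc x
    have hint : ∫⁻ y in tsupport f, ENNReal.ofReal (∏ j, cauchyWeight l (x j - y j)) ≤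
        ENNReal.ofReal (t.card * (l * D * Real.pi ^ 2)) := by
      have hsub : tsupport f ⊆ ⋃ p ∈ t, tsupport f ∩ U p := by
        rw [← Set.inter_iUnion₂]
        exact Set.subset_inter subset_rfl hcov
      refine (lintegral_mono_set hsub).trans ((setLIntegral_biUnion_finset_le t _ _).trans ?_)
      refine (Finset.sum_le_card_nsmul t _ (ENNReal.ofReal (l * D * Real.pi ^ 2))
        fun p hp => ?_).trans_eq ?_
      · exact (hsl p hp).setLIntegral_prod_cauchyWeight_le hD
          ((isClosed_tsupport f).measurableSet.inter (hU p).measurableSet) hl x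
      · rw [ENNReal.ofReal_mul (p := (t.card : ℝ)) (Nat.cast_nonneg _), ENNReal.ofReal_natCast, nsmul_eq_mul]
    have h2 := h.trans (mul_le_mul_right hint _)
    rw [← ENNReal.ofReal_mul (by positivity), ← ofReal_norm,
      ENNReal.ofReal_le_ofReal_iff (by positivity)] at h2
    refine h2.trans ?_
    have : 0 ≤ A * C0Norm f * (t.card * (l * D * Real.pi ^ 2)) * Real.pi := by positivity
    linarith

/-- A function on `ℝ³` vanishing outside a ball has compact support. -/
lemma hasCompactSupport_of_norm3 {ψ : V3 → ℝ} {R : ℝ} (h : ∀ ξ, ¬ norm3 ξ < R → ψ ξ = 0) :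
    HasCompactSupport ψ := by
  refine HasCompactSupport.intro (isCompact_closedBall (0 : V3) R) fun ξ hξ => h ξ fun hlt => hξ ?_
  rw [mem_closedBall_zero_iff]
  exact (norm_le_norm3 ξ).trans hlt.le

lemma rpow_mul_min_one_le {l r α : ℝ} (hl : 0 < l) (hr : 0 < r) (hα0 : 0 < α) (hα1 : α < 1) :
    l ^ (-1 + α) * min 1 (l * r) ≤ r ^ (1 - α) := by
  have hlr : 0 < l * r := mul_pos hl hr
  have hmin : min 1 (l * r) ≤ (l * r) ^ (1 - α) := by
    rcases le_total 1 (l * r) with h | h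
    · exact (min_le_left _ _).trans (Real.one_le_rpow h (by linarith))
    · refine (min_le_right _ _).trans ?_
      simpa using Real.rpow_le_rpow_of_exponent_ge hlr h (by linarith : 1 - α ≤ 1)
  calc l ^ (-1 + α) * min 1 (l * r) ≤ l ^ (-1 + α) * (l * r) ^ (1 - α) := by gcongr
    _ = l ^ (-1 + α) * l ^ (1 - α) * r ^ (1 - α) := by rw [Real.mul_rpow hl.le hr.le]; ring
    _ = r ^ (1 - α) := by rw [← Real.rpow_add hl]; simp

/-- **Lemma A.4 (Besov estimate for functions supported in a small collar).** Let `Ω ⊂ ℝ³`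
be a bounded domain with smooth boundary and `α ∈ (0,1)`. For `r > 0` small enough
(depending on `Ω`), any `f ∈ C_c^∞(ℝ³)` supported in `{0 < dist(x,Ω) < r}` satisfies
`‖f‖_{B^{-1+α}_{∞,∞}} ≤ C(Ω,α) r^{1-α} ‖f‖₀`. -/
theorem besov_estimate_small_collar
    (Ω : Set V3) (hΩ : SmoothDomain Ω)
    (α : ℝ) (hα0 : 0 < α) (hα1 : α < 1)
    (χ φLP : V3 → ℝ) (hLP : LPpair χ φLP) :
    ∃ r₀ : ℝ, 0 < r₀ ∧ ∃ C : ℝ, 0 < C ∧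
      ∀ r : ℝ, 0 < r → r ≤ r₀ →
      ∀ f : V3 → ℝ, ContDiff ℝ (⊤ : ℕ∞) f → HasCompactSupport f →
        tsupport f ⊆ {x : V3 | 0 < infDist3 x Ω ∧ infDist3 x Ω < r} →
        BesovNormR χ φLP (-1 + α) f ≤ C * r ^ (1 - α) * C0Norm f := by
  obtain ⟨r₀, hr₀, C, hC, t, U, i, hU, hcollar⟩ := hΩ.exists_cover_collar
  have hφc : HasCompactSupport φLP := hasCompactSupport_of_norm3 (R := 8 / 3)
    fun ξ hξ => hLP.suppAnn ξ fun h => hξ h.2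
  obtain ⟨B, hB0, hB⟩ := exists_norm_fmult_le hLP.smooth (hasCompactSupport_of_norm3 hLP.suppLow)
  obtain ⟨B', hB'0, hB'⟩ := exists_norm_fmult_le hLP.smooth' hφc
  set K : ℝ := 1 + t.card * C with hK
  have hK1 : 1 ≤ K := by rw [hK]; linarith [mul_nonneg (Nat.cast_nonneg (α := ℝ) t.card) hC.le]
  refine ⟨r₀, hr₀, (B + B') * K, by positivity, fun r hr hrr f hf hfc hsupp => ?_⟩
  have hM := C0Norm_nonneg f
  obtain ⟨hcov, hsl⟩ := hcollar r hr hrr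
  have key : ∀ ψ : V3 → ℝ, ∀ b : ℝ, 0 < b → (∀ l > 0, ∀ f : V3 → ℝ, Continuous f →
      HasCompactSupport f → ∀ x,
      ‖fmult (fun ξ => ψ (l⁻¹ • ξ)) (fun y => (f y : ℂ)) x‖ ≤ b * C0Norm f ∧
      ∀ (t : Finset V3) (U : V3 → Set V3) (i : V3 → Fin 3) (D : ℝ), 0 ≤ D →
        (∀ p, IsOpen (U p)) → tsupport f ⊆ ⋃ p ∈ t, U p →
        (∀ p ∈ t, SlicesLE (i p) D (tsupport f ∩ U p)) →
        ‖fmult (fun ξ => ψ (l⁻¹ • ξ)) (fun y => (f y : ℂ)) x‖ ≤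
          b * C0Norm f * (t.card * (l * D))) →
      ∀ l > 0, l ^ (-1 + α) * C0Norm (fmult (fun ξ => ψ (l⁻¹ • ξ)) fun y => (f y : ℂ)) ≤
        b * K * r ^ (1 - α) * C0Norm f := by
    intro ψ b hb h l hl
    have hsup : C0Norm (fmult (fun ξ => ψ (l⁻¹ • ξ)) fun y => (f y : ℂ)) ≤
        b * K * C0Norm f * min 1 (l * r) := by
      refine ciSup_le fun x => ?_
      obtain ⟨h1, h2⟩ := h l hl f hf.continuous hfc x
      specialize h2 t U i (C * r) (by positivity) hU (hsupp.trans hcov)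
        fun p hp => (hsl p hp).mono (Set.inter_subset_inter_left _ hsupp)
      have hbM : 0 ≤ b * C0Norm f := by positivity
      rcases min_cases 1 (l * r) with ⟨he, -⟩ | ⟨he, -⟩ <;> rw [he]
      · nlinarith
      · have : 0 ≤ b * C0Norm f * (l * r) := by positivity
        rw [hK]
        linarith
    calc _ ≤ l ^ (-1 + α) * (b * K * C0Norm f * min 1 (l * r)) := by gcongr
      _ = b * K * C0Norm f * (l ^ (-1 + α) * min 1 (l * r)) := by ring
      _ ≤ b * K * C0Norm f * r ^ (1 - α) := by
          gcongr
          exact rpow_mul_min_one_le hl hr hα0 hα1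
      _ = _ := by ring
  have hlow := key χ B hB0 hB 1 one_pos
  simp only [Real.one_rpow, inv_one, one_smul, one_mul] at hlow
  have hdyad : ⨆ N : ℕ, (2:ℝ) ^ ((N:ℝ) * (-1 + α)) *
      C0Norm (dyadProj φLP N fun x => (f x : ℂ)) ≤ B' * K * r ^ (1 - α) * C0Norm f := by
    refine ciSup_le fun N => ?_
    have h := key φLP B' hB'0 hB' ((2:ℝ) ^ N) (by positivity)
    rw [← Real.rpow_natCast_mul zero_le_two] at h
    simpa only [dyadProj, zpow_neg, zpow_natCast] using h
  calc BesovNormR χ φLP (-1 + α) f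
      ≤ B * K * r ^ (1 - α) * C0Norm f + B' * K * r ^ (1 - α) * C0Norm f := add_le_add hlow hdyad
    _ = _ := by ring
end
end
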